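/- arXiv:2502.00770 — 6 statements merged into one kernel-verified Lean document; each statement's English description precedes it below -/
import Mathlib

section
/- Let K/F be a cyclic Galois field extension of degree n ≥ 3, let m ≥ 2 be an integer with n ≥ m−1, and let σ₁ and σ₂ be two distinct generators of Gal(K/F). Then for any a₁, a₂ ∈ K ∖ F, the Petit algebras S_{t^m−a₁} (formed in K[t;σ₁]) and S_{t^m−a₂} (formed in K[t;σ₂]) are not isomorphic as F-algebras, i.e. there is no F-linear bijection between them preserving multiplication. -/
/-- The multiplication of the Petit algebra `S_{t^m - a} = K[t;σ]/K[t;σ](t^m - a)`,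
on the `F`-vector space `Fin m → K` (coordinates with respect to the `K`-basis
`t^0, …, t^{m-1}`): the `F`-bilinear map determined by
`(x t^i)·(y t^j) = x σ^i(y) t^{i+j}` if `i+j ≤ m-1`, and
`(x t^i)·(y t^j) = x σ^i(y) σ^{i+j-m}(a) t^{i+j-m}` if `m ≤ i+j ≤ 2m-2`. -/
noncomputable def petitMul {F K : Type*} [Field F] [Field K] [Algebra F K]
    (σ : K ≃ₐ[F] K) (a : K) (m : ℕ) (x y : Fin m → K) : Fin m → K :=
  fun l =>
    (∑ i : Fin m, ∑ j : Fin m,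
      if (i : ℕ) + (j : ℕ) = (l : ℕ) then x i * (σ ^ (i : ℕ)) (y j) else 0)
    + (∑ i : Fin m, ∑ j : Fin m,
      if (i : ℕ) + (j : ℕ) = (l : ℕ) + m then
        x i * (σ ^ (i : ℕ)) (y j) * (σ ^ (l : ℕ)) a else 0)

/-- The Petit algebras `K[t;σ₁]/K[t;σ₁](t^m - a₁)` and `K[t;σ₂]/K[t;σ₂](t^m - a₂)`
are isomorphic as `F`-algebras: there is an `F`-linear bijection preserving
multiplication. -/
def PetitIso {F K : Type*} [Field F] [Field K] [Algebra F K]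
    (σ₁ σ₂ : K ≃ₐ[F] K) (a₁ a₂ : K) (m : ℕ) : Prop :=
  ∃ e : (Fin m → K) ≃ₗ[F] (Fin m → K),
    ∀ x y : Fin m → K, e (petitMul σ₁ a₁ m x y) = petitMul σ₂ a₂ m (e x) (e y)

section Petit

variable {F K : Type*} [Field F] [Field K] [Algebra F K]

/-- The monomial `x t^j`, as a coordinate vector. -/
def petitMonomial (m j : ℕ) (x : K) : Fin m → K := fun l => if (l : ℕ) = j then x else 0

theorem petitMonomial_injective {m j : ℕ} (hj : j < m) :
    Function.Injective (petitMonomial (K := K) m j) := fun x y h => by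
  simpa [petitMonomial] using congrFun h ⟨j, hj⟩

theorem petitMonomial_zero (m j : ℕ) : petitMonomial m j (0 : K) = 0 := by
  funext l
  simp [petitMonomial]

theorem petitMul_monomial_apply (σ : K ≃ₐ[F] K) (a : K) {m j : ℕ} (hj : j < m) (v : Fin m → K)
    (y : K) (l : Fin m) :
    petitMul σ a m v (petitMonomial m j y) l =
      if h : j ≤ (l : ℕ) then
        v ⟨l - j, by omega⟩ * (σ ^ ((l : ℕ) - j)) y
      else
        v ⟨l + m - j, by omega⟩ * (σ ^ ((l : ℕ) + m - j)) y * (σ ^ (l : ℕ)) a := by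
  have hl := l.2
  unfold petitMul
  have inner₁ : ∀ i : Fin m, (∑ j' : Fin m, if (i : ℕ) + (j' : ℕ) = (l : ℕ) then
      v i * (σ ^ (i : ℕ)) (petitMonomial m j y j') else 0) =
      if (i : ℕ) + j = (l : ℕ) then v i * (σ ^ (i : ℕ)) y else 0 := fun i => by
    rw [Finset.sum_eq_single ⟨j, hj⟩]
    · simp [petitMonomial]
    · intro b _ hb
      have : (b : ℕ) ≠ j := fun h => hb (Fin.ext h)
      simp [petitMonomial, this]
    · simp
  have inner₂ : ∀ i : Fin m, (∑ j' : Fin m, if (i : ℕ) + (j' : ℕ) = (l : ℕ) + m then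
      v i * (σ ^ (i : ℕ)) (petitMonomial m j y j') * (σ ^ (l : ℕ)) a else 0) =
      if (i : ℕ) + j = (l : ℕ) + m then v i * (σ ^ (i : ℕ)) y * (σ ^ (l : ℕ)) a else 0 :=
    fun i => by
    rw [Finset.sum_eq_single ⟨j, hj⟩]
    · simp [petitMonomial]
    · intro b _ hb
      have : (b : ℕ) ≠ j := fun h => hb (Fin.ext h)
      simp [petitMonomial, this]
    · simp
  simp only [inner₁, inner₂]
  split_ifs with h
  · rw [Finset.sum_eq_single ⟨l - j, by omega⟩, Finset.sum_eq_zero, add_zero, if_pos]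
    · simp only; omega
    · intro i _
      rw [if_neg]
      have := i.2
      omega
    · intro b _ hb
      rw [if_neg]
      intro h'
      exact hb (Fin.ext (by simp only; omega))
    · simp
  · rw [Finset.sum_eq_zero, zero_add, Finset.sum_eq_single ⟨l + m - j, by omega⟩, if_pos]
    · simp only; omega
    · intro b _ hb
      rw [if_neg]
      intro h'
      exact hb (Fin.ext (by simp only; omega))
    · simp
    · intro i _
      rw [if_neg]
      omega

theorem petitMonomial_mul_of_lt (σ : K ≃ₐ[F] K) (a : K) {m i j : ℕ} (h : i + j < m) (x y : K) :
    petitMul σ a m (petitMonomial m i x) (petitMonomial m j y) =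
      petitMonomial m (i + j) (x * (σ ^ i) y) := by
  funext l
  have hl := l.2
  rw [petitMul_monomial_apply σ a (by omega)]
  by_cases hl' : (l : ℕ) = i + j
  · have h1 : j ≤ (l : ℕ) := by omega
    have h2 : (l : ℕ) - j = i := by omega
    simp [petitMonomial, hl']
  · split_ifs with h1
    · have h2 : (l : ℕ) - j ≠ i := by omega
      simp [petitMonomial, hl', h2]
    · have h2 : (l : ℕ) + m - j ≠ i := by omega
      simp [petitMonomial, hl', h2]

theorem petitMonomial_mul_of_le (σ : K ≃ₐ[F] K) (a : K) {m i j : ℕ} (hi : i < m) (hj : j < m)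
    (h : m ≤ i + j) (x y : K) :
    petitMul σ a m (petitMonomial m i x) (petitMonomial m j y) =
      petitMonomial m (i + j - m) (x * (σ ^ i) y * (σ ^ (i + j - m)) a) := by
  funext l
  have hl := l.2
  rw [petitMul_monomial_apply σ a hj]
  by_cases hl' : (l : ℕ) = i + j - m
  · have h1 : ¬ j ≤ (l : ℕ) := by omega
    have h2 : i + j - m + m - j = i := by omega
    rw [dif_neg h1]
    simp only [petitMonomial, hl', h2, if_true]
  · split_ifs with h1
    · have h2 : (l : ℕ) - j ≠ i := by omega
      simp [petitMonomial, hl', h2]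
    · have h2 : (l : ℕ) + m - j ≠ i := by omega
      simp [petitMonomial, hl', h2]

theorem petitMul_smul_left (σ : K ≃ₐ[F] K) (a : K) (m : ℕ) (c : K) (x y : Fin m → K) :
    petitMul σ a m (c • x) y = c • petitMul σ a m x y := by
  funext l
  simp only [petitMul, Pi.smul_apply, smul_eq_mul, mul_add, Finset.mul_sum, mul_ite, mul_zero,
    mul_assoc]

theorem petitMul_one_left (σ : K ≃ₐ[F] K) (a : K) {m : ℕ} (hm : 0 < m) (y : Fin m → K) :
    petitMul σ a m (petitMonomial m 0 1) y = y := by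
  funext l
  have hl := l.2
  have hi : ∀ i : Fin m, i ≠ ⟨0, hm⟩ → (i : ℕ) ≠ 0 := fun i h h' => h (Fin.ext h')
  have hwrap : (∑ i : Fin m, ∑ j : Fin m, if (i : ℕ) + (j : ℕ) = (l : ℕ) + m then
      petitMonomial m 0 (1 : K) i * (σ ^ (i : ℕ)) (y j) * (σ ^ (l : ℕ)) a else 0) = 0 := by
    refine Finset.sum_eq_zero fun i _ => Finset.sum_eq_zero fun j _ => ?_
    have := j.2
    by_cases h0 : (i : ℕ) = 0
    · rw [if_neg]
      omega
    · simp [petitMonomial, h0]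
  rw [petitMul, hwrap, add_zero, Finset.sum_eq_single ⟨0, hm⟩, Finset.sum_eq_single l]
  · simp [petitMonomial]
  · intro j _ hj
    have : (j : ℕ) ≠ l := fun h => hj (Fin.ext h)
    simp [this]
  · simp
  · intro i _ h
    simp [petitMonomial, hi i h]
  · simp

theorem petitMonomial_zero_eq_smul (m : ℕ) (c : K) :
    petitMonomial m 0 c = c • petitMonomial m 0 (1 : K) := by
  funext l
  simp [petitMonomial]

theorem petitMul_monomial_zero_left (σ : K ≃ₐ[F] K) (a : K) {m : ℕ} (hm : 0 < m) (c : K)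
    (y : Fin m → K) : petitMul σ a m (petitMonomial m 0 c) y = c • y := by
  rw [petitMonomial_zero_eq_smul, petitMul_smul_left, petitMul_one_left σ a hm]

/-- If `σ a ≠ a`, the left nucleus of the Petit algebra is contained in `K`. -/
theorem eq_petitMonomial_zero_of_mem_leftNucleus (σ : K ≃ₐ[F] K) {a : K} (ha : σ a ≠ a) {m : ℕ}
    (hm : 2 ≤ m) {v : Fin m → K}
    (hv : ∀ y z, petitMul σ a m (petitMul σ a m v y) z = petitMul σ a m v (petitMul σ a m y z)) :
    v = petitMonomial m 0 (v ⟨0, by omega⟩) := by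
  funext l
  have hl := l.2
  by_cases h0 : (l : ℕ) = 0
  · have : l = ⟨0, by omega⟩ := Fin.ext h0
    rw [this]
    simp [petitMonomial]
  have h := congrFun (hv (petitMonomial m (m - 1) 1) (petitMonomial m 1 1)) l
  rw [petitMonomial_mul_of_le σ a (by omega) (by omega) (by omega),
    show m - 1 + 1 - m = 0 by omega, petitMul_monomial_apply σ a (by omega),
    petitMul_monomial_apply σ a (by omega), dif_pos (by omega), dif_pos (by omega),
    petitMul_monomial_apply σ a (by omega), dif_neg (by simp only; omega)] at h
  simp only [show (l : ℕ) - 1 + m - (m - 1) = l by omega, map_one, mul_one, one_mul, pow_zero,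
    Nat.sub_zero, AlgEquiv.one_apply] at h
  have hpow : (σ ^ (l : ℕ)) a = (σ ^ ((l : ℕ) - 1)) (σ a) := by
    rw [← AlgEquiv.mul_apply, ← pow_succ, Nat.sub_add_cancel (by omega)]
  rw [hpow] at h
  have hne : (σ ^ ((l : ℕ) - 1)) a ≠ (σ ^ ((l : ℕ) - 1)) (σ a) :=
    fun h' => ha ((σ ^ ((l : ℕ) - 1)).injective h').symm
  have : v l = 0 := by
    by_contra hvl
    exact hne (mul_left_cancel₀ hvl h)
  simp [petitMonomial, h0, this]

/-- If `e` is an isomorphism of Petit algebras, then `e` restricts to an `F`-automorphism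
of `K`. -/
theorem exists_algEquiv_of_petitIso [FiniteDimensional F K] {σ₁ σ₂ : K ≃ₐ[F] K} {a₁ a₂ : K}
    {m : ℕ} (hm : 2 ≤ m) (ha₂ : σ₂ a₂ ≠ a₂) (e : (Fin m → K) ≃ₗ[F] (Fin m → K))
    (he : ∀ x y, e (petitMul σ₁ a₁ m x y) = petitMul σ₂ a₂ m (e x) (e y)) :
    ∃ τ : K ≃ₐ[F] K, ∀ c, e (petitMonomial m 0 c) = petitMonomial m 0 (τ c) := by
  have hm0 : 0 < m := by omega
  let τ : K → K := fun c => e (petitMonomial m 0 c) ⟨0, hm0⟩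
  have hτ : ∀ c, e (petitMonomial m 0 c) = petitMonomial m 0 (τ c) := fun c => by
    refine eq_petitMonomial_zero_of_mem_leftNucleus σ₂ ha₂ hm fun y z => ?_
    obtain ⟨y, rfl⟩ := e.surjective y
    obtain ⟨z, rfl⟩ := e.surjective z
    simp only [← he, petitMul_monomial_zero_left _ _ hm0, petitMul_smul_left]
  have hinj : Function.Injective τ := fun c d h =>
    petitMonomial_injective hm0 (e.injective (by rw [hτ, hτ, h]))
  have hadd : ∀ c d, τ (c + d) = τ c + τ d := fun c d => by
    have : petitMonomial m 0 (c + d) = petitMonomial m 0 c + petitMonomial m 0 d := by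
      funext l
      by_cases h : (l : ℕ) = 0 <;> simp [petitMonomial, h]
    simp only [τ, this, map_add, Pi.add_apply]
  have hsmul : ∀ (r : F) c, τ (r • c) = r • τ c := fun r c => by
    have : petitMonomial m 0 (r • c) = r • petitMonomial m 0 c := by
      funext l
      by_cases h : (l : ℕ) = 0 <;> simp [petitMonomial, h]
    simp only [τ, this, map_smul, Pi.smul_apply]
  have hmul : ∀ c d, τ (c * d) = τ c * τ d := fun c d => by
    apply petitMonomial_injective hm0
    have h := he (petitMonomial m 0 c) (petitMonomial m 0 d)
    rw [petitMonomial_mul_of_lt σ₁ a₁ (by omega), hτ, hτ, hτ,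
      petitMonomial_mul_of_lt σ₂ a₂ (by omega)] at h
    simpa using h
  have hzero : τ 0 = 0 := by simpa using hsmul 0 0
  have hone : τ 1 = 1 := by
    have h1 : τ 1 ≠ 0 := fun h => one_ne_zero (hinj (h.trans hzero.symm))
    have h2 := hmul 1 1
    rw [mul_one] at h2
    exact mul_left_cancel₀ h1 (by rw [← h2, mul_one])
  let τL : K →ₗ[F] K := { toFun := τ, map_add' := hadd, map_smul' := hsmul }
  let τA : K →ₐ[F] K := AlgHom.ofLinearMap τL hone hmul
  exact ⟨AlgEquiv.ofBijective τA
    ⟨hinj, LinearMap.injective_iff_surjective.mp (show Function.Injective τL from hinj)⟩, hτ⟩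

/-- An element fixed by a generator of the Galois group lies in the base field. -/
theorem mem_range_algebraMap_of_generator_fixed [IsGalois F K] [FiniteDimensional F K]
    {σ : K ≃ₐ[F] K} (hσ : ∀ τ : K ≃ₐ[F] K, τ ∈ Subgroup.zpowers σ) {a : K} (ha : σ a = a) :
    a ∈ Set.range (algebraMap F K) := by
  rw [IsGalois.mem_range_algebraMap_iff_fixed]
  intro τ
  have : Subgroup.zpowers σ ≤ MulAction.stabilizer (K ≃ₐ[F] K) a := by
    rw [Subgroup.zpowers_le]
    exact ha
  exact this (hσ τ)

/-- If `σ^m = 1` and the monomials `c t^A`, `k t^i`, `k t^i` associate although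
`A + i ≥ m`, then `σ^i` fixes `a`. -/
theorem pow_apply_eq_of_petitMonomial_assoc {σ : K ≃ₐ[F] K} {a : K} {m : ℕ} (ha : a ≠ 0)
    (hσ : σ ^ m = 1) {A i : ℕ} (hA : A < m) (hi : i < m) (h : m ≤ A + i) {c k : K}
    (hc : c ≠ 0) (hk : k ≠ 0)
    (hass : petitMul σ a m (petitMul σ a m (petitMonomial m A c) (petitMonomial m i k))
        (petitMonomial m i k) =
      petitMul σ a m (petitMonomial m A c)
        (petitMul σ a m (petitMonomial m i k) (petitMonomial m i k))) :
    (σ ^ i) a = a := by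
  obtain ⟨B, hB⟩ := Nat.exists_eq_add_of_le h
  have hpow : ∀ j x, (σ ^ (m + j)) x = (σ ^ j) x := fun j x => by rw [pow_add, hσ, one_mul]
  have hadd : ∀ s t x, (σ ^ s) ((σ ^ t) x) = (σ ^ (s + t)) x := fun s t x => by
    rw [pow_add, AlgEquiv.mul_apply]
  have hne : ∀ s {x : K}, x ≠ 0 → (σ ^ s) x ≠ 0 := fun s x hx => (map_ne_zero _).mpr hx
  have fixed : (σ ^ B) a = (σ ^ (B + i)) a → (σ ^ i) a = a := fun h' =>
    (σ ^ B).injective (by rw [hadd, h'])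
  have cancel : c * (σ ^ A) k * (σ ^ B) a * (σ ^ B) k =
      c * ((σ ^ A) k * (σ ^ B) k) * (σ ^ (B + i)) a → (σ ^ B) a = (σ ^ (B + i)) a := fun h' => by
    have hcoef : c * ((σ ^ A) k * (σ ^ B) k) ≠ 0 :=
      mul_ne_zero hc (mul_ne_zero (hne A hk) (hne B hk))
    exact mul_left_cancel₀ hcoef (by rw [← h']; ring)
  apply fixed
  apply cancel
  rw [petitMonomial_mul_of_le σ a hA hi h, show A + i - m = B by omega] at hass
  by_cases h2 : i + i < m
  · rw [petitMonomial_mul_of_lt σ a (by omega), petitMonomial_mul_of_lt σ a h2,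
      petitMonomial_mul_of_le σ a hA h2 (by omega),
      show A + (i + i) - m = B + i by omega] at hass
    have := petitMonomial_injective (by omega) hass
    rwa [map_mul, hadd, hB, hpow] at this
  · rw [petitMonomial_mul_of_le σ a hi hi (by omega)] at hass
    by_cases h3 : B + i < m
    · rw [petitMonomial_mul_of_lt σ a h3, petitMonomial_mul_of_lt σ a (by omega),
        show A + (i + i - m) = B + i by omega] at hass
      have := petitMonomial_injective (by omega) hass
      rwa [map_mul, map_mul, hadd, hadd, hB, hpow, show A + (i + i - m) = B + i by omega,
        ← mul_assoc c] at this
    · rw [petitMonomial_mul_of_le σ a (by omega) hi (by omega),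
        petitMonomial_mul_of_le σ a hA (by omega) (by omega),
        show A + (i + i - m) - m = B + i - m by omega] at hass
      have := mul_right_cancel₀ (hne _ ha) (petitMonomial_injective (by omega) hass)
      rwa [map_mul, map_mul, hadd, hadd, hB, hpow, show A + (i + i - m) = B + i by omega,
        ← mul_assoc c] at this

end Petit

/-- Let `K/F` be a cyclic Galois field extension of degree `n ≥ 3`,
let `m ≥ 2` with `n ≥ m - 1`, and let `σ₁ ≠ σ₂` be two generators of `Gal(K/F)`.
Then for any `a₁, a₂ ∈ K ∖ F` the Petit algebras `S_{t^m - a₁}` (formed in `K[t;σ₁]`)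
and `S_{t^m - a₂}` (formed in `K[t;σ₂]`) are not isomorphic as `F`-algebras. -/
theorem stmt_0 {F K : Type*} [Field F] [Field K] [Algebra F K]
    [IsGalois F K] [FiniteDimensional F K]
    (n m : ℕ) (hdeg : Module.finrank F K = n) (hn : 3 ≤ n) (hm : 2 ≤ m) (hnm : m - 1 ≤ n)
    (σ₁ σ₂ : K ≃ₐ[F] K)
    (hgen₁ : ∀ τ : K ≃ₐ[F] K, τ ∈ Subgroup.zpowers σ₁)
    (hgen₂ : ∀ τ : K ≃ₐ[F] K, τ ∈ Subgroup.zpowers σ₂)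
    (hne : σ₁ ≠ σ₂)
    (a₁ a₂ : K)
    (ha₁ : a₁ ∉ Set.range (algebraMap F K))
    (ha₂ : a₂ ∉ Set.range (algebraMap F K)) :
    ¬ PetitIso σ₁ σ₂ a₁ a₂ m := by
  rintro ⟨e, he⟩
  have hσa₂ : σ₂ a₂ ≠ a₂ := fun h => ha₂ (mem_range_algebraMap_of_generator_fixed hgen₂ h)
  have ha0 : a₂ ≠ 0 := fun h => ha₂ ⟨0, by rw [map_zero, h]⟩
  obtain ⟨τ, hτ⟩ := exists_algEquiv_of_petitIso hm hσa₂ e he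
  have hm0 : 0 < m := by omega
  have hord : orderOf σ₂ = n := by
    rw [orderOf_eq_card_of_forall_mem_zpowers hgen₂, IsGalois.card_aut_eq_finrank, hdeg]
  have hσ₁ : σ₁ ≠ 1 := fun h => by
    have h1 : orderOf σ₁ = n := by
      rw [orderOf_eq_card_of_forall_mem_zpowers hgen₁, IsGalois.card_aut_eq_finrank, hdeg]
    rw [h, orderOf_one] at h1
    omega
  have hcomm : σ₁ * τ = τ * σ₁ := by
    obtain ⟨z, rfl⟩ := Subgroup.mem_zpowers_iff.mp (hgen₁ τ)
    exact ((Commute.refl σ₁).zpow_right z).eq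
  set w := e (petitMonomial m 1 1) with hw
  -- `t x = σ₁ x t` forces `w` to be supported on exponents `l` with `σ₂ ^ l = σ₁`
  have hsupp : ∀ l : Fin m, w l ≠ 0 → σ₂ ^ (l : ℕ) = σ₁ := fun l hl => by
    ext y
    obtain ⟨x, rfl⟩ := τ.surjective y
    have h1 : petitMul σ₁ a₁ m (petitMonomial m 1 1) (petitMonomial m 0 x) =
        petitMul σ₁ a₁ m (petitMonomial m 0 (σ₁ x)) (petitMonomial m 1 1) := by
      rw [petitMonomial_mul_of_lt σ₁ a₁ (by omega), petitMonomial_mul_of_lt σ₁ a₁ (by omega)]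
      simp
    have h2 := congrArg e h1
    rw [he, he, hτ, hτ, ← hw, petitMul_monomial_zero_left σ₂ a₂ hm0] at h2
    have h3 := congrFun h2 l
    rw [petitMul_monomial_apply σ₂ a₂ hm0, dif_pos (Nat.zero_le _)] at h3
    simp only [Nat.sub_zero, Pi.smul_apply, smul_eq_mul] at h3
    rw [mul_comm] at h3
    rw [mul_right_cancel₀ hl h3, ← AlgEquiv.mul_apply, ← hcomm, AlgEquiv.mul_apply]
  have hw0 : w ≠ 0 := fun h => by
    have h1 : petitMonomial m 1 (1 : K) = 0 := e.injective (by rw [← hw, h, map_zero])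
    rw [← petitMonomial_zero] at h1
    exact one_ne_zero (petitMonomial_injective (by omega) h1)
  obtain ⟨⟨i, hi⟩, hwi⟩ := Function.ne_iff.mp hw0
  have hwi : w ⟨i, hi⟩ ≠ 0 := hwi
  have hσi : σ₂ ^ i = σ₁ := hsupp _ hwi
  have hbound : ∀ l < m, σ₂ ^ l = σ₁ → l ≠ 0 ∧ l < n := fun l hl h => by
    refine ⟨fun h0 => hσ₁ (by rw [← h, h0, pow_zero]), lt_of_le_of_ne (by omega) fun h0 => ?_⟩
    exact hσ₁ (by rw [← h, h0, ← hord, pow_orderOf_eq_one])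
  obtain ⟨hi0, hin⟩ := hbound i hi hσi
  have hi2 : 2 ≤ i := by
    have : i ≠ 1 := fun h => hne (by rw [← hσi, h, pow_one])
    omega
  set k := w ⟨i, hi⟩ with hk
  have hwk : w = petitMonomial m i k := by
    funext l
    by_cases hl : (l : ℕ) = i
    · have : l = ⟨i, hi⟩ := Fin.ext hl
      simp [petitMonomial, this, hk]
    · have : w l = 0 := by
        by_contra h
        have h1 := hsupp l h
        have h2 := (hbound l l.2 h1).2
        exact hl (pow_injOn_Iio_orderOf (by simpa [hord] using h2) (by simpa [hord] using hin)
          (h1.trans hσi.symm))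
      simp [petitMonomial, hl, this]
  have hpow : ∀ j, i * j < m → ∃ c : K, c ≠ 0 ∧ e (petitMonomial m j 1) =
      petitMonomial m (i * j) c := fun j => by
    induction j with
    | zero => exact fun _ => ⟨1, one_ne_zero, by rw [hτ, map_one, mul_zero]⟩
    | succ j ih =>
      intro hj
      rw [mul_add, mul_one] at hj
      obtain ⟨c, hc, hce⟩ := ih (by omega)
      have hjm : j + 1 < m := by nlinarith
      have h := he (petitMonomial m j 1) (petitMonomial m 1 1)
      rw [petitMonomial_mul_of_lt σ₁ a₁ hjm, hce, ← hw, hwk,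
        petitMonomial_mul_of_lt σ₂ a₂ hj] at h
      exact ⟨c * (σ₂ ^ (i * j)) k, mul_ne_zero hc ((map_ne_zero _).mpr hwi), by simpa [mul_add] using h⟩
  -- the first power of `w` whose product with `w` wraps around
  obtain ⟨r, hr1, hrm, hrw⟩ : ∃ r, 1 ≤ r ∧ i * r < m ∧ m ≤ i * r + i := by
    have hdiv := Nat.div_add_mod (m - 1) i
    have hmod := Nat.mod_lt (m - 1) (show 0 < i by omega)
    exact ⟨(m - 1) / i, Nat.div_pos (by omega) (by omega), by omega, by omega⟩
  have hr2 : r + 2 ≤ m := by nlinarith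
  obtain ⟨c, hc, hce⟩ := hpow r hrm
  have hk0 : k ≠ 0 := hwi
  have hσm : σ₂ ^ m = 1 := by
    obtain ⟨B, hB⟩ := Nat.exists_eq_add_of_le hrw
    have hBm : σ₂ ^ (i * r + i) = σ₂ ^ B := by
      ext y
      obtain ⟨x, rfl⟩ := τ.surjective y
      have h1 : petitMul σ₁ a₁ m (petitMul σ₁ a₁ m (petitMonomial m r 1) (petitMonomial m 1 1))
            (petitMonomial m 0 x) =
          petitMul σ₁ a₁ m (petitMonomial m r 1)
            (petitMul σ₁ a₁ m (petitMonomial m 1 1) (petitMonomial m 0 x)) := by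
        rw [petitMonomial_mul_of_lt σ₁ a₁ (by omega), petitMonomial_mul_of_lt σ₁ a₁ (by omega),
          petitMonomial_mul_of_lt σ₁ a₁ (by omega), petitMonomial_mul_of_lt σ₁ a₁ (by omega)]
        simp [pow_add]
      have h2 := congrArg e h1
      rw [he, he, he, he, hτ, hce, ← hw, hwk, petitMonomial_mul_of_le σ₂ a₂ hrm hi hrw,
        petitMonomial_mul_of_lt σ₂ a₂ (by omega), petitMonomial_mul_of_lt σ₂ a₂ (by omega),
        petitMonomial_mul_of_le σ₂ a₂ hrm (by omega) (by omega),
        show i * r + (i + 0) - m = B by omega, show i * r + i - m + 0 = B by omega,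
        show i * r + i - m = B by omega] at h2
      have h3 := petitMonomial_injective (by omega) h2
      rw [map_mul, ← AlgEquiv.mul_apply (σ₂ ^ (i * r)) (σ₂ ^ i), ← pow_add] at h3
      have hne' : ∀ s {x : K}, x ≠ 0 → (σ₂ ^ s) x ≠ 0 := fun s x hx => (map_ne_zero _).mpr hx
      refine mul_left_cancel₀ (mul_ne_zero (mul_ne_zero hc (hne' (i * r) hk0)) (hne' B ha0)) ?_
      rw [h3]
      ring
    rw [hB, pow_add] at hBm
    exact mul_eq_right.mp hBm
  have hassoc : petitMul σ₁ a₁ m (petitMul σ₁ a₁ m (petitMonomial m r 1) (petitMonomial m 1 1))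
        (petitMonomial m 1 1) =
      petitMul σ₁ a₁ m (petitMonomial m r 1)
        (petitMul σ₁ a₁ m (petitMonomial m 1 1) (petitMonomial m 1 1)) := by
    rw [petitMonomial_mul_of_lt σ₁ a₁ (by omega),
      petitMonomial_mul_of_lt σ₁ a₁ (show 1 + 1 < m by omega)]
    rcases hr2.lt_or_eq with h | h
    · rw [petitMonomial_mul_of_lt σ₁ a₁ (by omega), petitMonomial_mul_of_lt σ₁ a₁ (by omega)]
      simp [add_assoc]
    · rw [petitMonomial_mul_of_le σ₁ a₁ (by omega) (by omega) (by omega),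
        petitMonomial_mul_of_le σ₁ a₁ (by omega) (by omega) (by omega)]
      simp [add_assoc]
  have hassoc' := congrArg e hassoc
  rw [he, he, he, he, hce, ← hw, hwk] at hassoc'
  have hfix := pow_apply_eq_of_petitMonomial_assoc ha0 hσm hrm hi hrw hc hk0 hassoc'
  rw [hσi] at hfix
  exact ha₂ (mem_range_algebraMap_of_generator_fixed hgen₁ hfix)
end

section
/- Let K/F be a cyclic Galois field extension of degree n ≥ 3 and let m ≥ 2 be an integer with n ≥ m−1. Then the cyclic group Gal(K/F) has exactly φ(n) generators, where φ is Euler's totient function, and for any family (a_σ)_σ of elements of K ∖ F indexed by the generators σ of Gal(K/F), the φ(n) Petit algebras S_{t^m−a_σ} (each formed in K[t;σ]) are pairwise non-isomorphic F-algebras; in other words, there are φ(n) distinct isomorphism classes of such algebras, one for each generator of Gal(K/F). -/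
section petitMul

variable {F K : Type*} [Field F] [Field K] [Algebra F K]
variable {σ : K ≃ₐ[F] K} {a : K} {m : ℕ}

theorem petitMul_single_left_of_add_eq {i r l : Fin m} (h : (i : ℕ) + r = l) (x : K)
    (y : Fin m → K) :
    petitMul σ a m (Pi.single i x) y l = x * (σ ^ (i : ℕ)) (y r) := by
  unfold petitMul
  rw [Finset.sum_eq_single i, Finset.sum_eq_single r, Finset.sum_eq_zero, add_zero]
  · simp [h]
  · intro i' _
    refine Finset.sum_eq_zero fun j _ => ?_
    by_cases hi : i' = i
    · subst hi
      rw [if_neg (by omega)]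
    · simp [hi]
  · intro j _ hj
    rw [if_neg fun h' => hj (Fin.ext (by omega))]
  · simp
  · intro i' _ hi
    simp [hi]
  · simp

theorem petitMul_single_left_of_add_eq_add {i r l : Fin m} (h : (i : ℕ) + r = l + m) (x : K)
    (y : Fin m → K) :
    petitMul σ a m (Pi.single i x) y l = x * (σ ^ (i : ℕ)) (y r) * (σ ^ (l : ℕ)) a := by
  unfold petitMul
  rw [add_comm, Finset.sum_eq_single i, Finset.sum_eq_single r, Finset.sum_eq_zero, add_zero]
  · simp [h]
  · intro i' _
    refine Finset.sum_eq_zero fun j _ => ?_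
    by_cases hi : i' = i
    · subst hi
      rw [if_neg (by omega)]
    · simp [hi]
  · intro j _ hj
    rw [if_neg fun h' => hj (Fin.ext (by omega))]
  · simp
  · intro i' _ hi
    simp [hi]
  · simp

theorem petitMul_single_right_of_add_eq {i j l : Fin m} (h : (i : ℕ) + j = l) (x : Fin m → K)
    (y : K) :
    petitMul σ a m x (Pi.single j y) l = x i * (σ ^ (i : ℕ)) y := by
  unfold petitMul
  rw [Finset.sum_eq_single i, Finset.sum_eq_single j, Finset.sum_eq_zero, add_zero]
  · simp [h]
  · intro i' _
    refine Finset.sum_eq_zero fun j' _ => ?_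
    by_cases hj : j' = j
    · subst hj
      rw [if_neg (by omega)]
    · simp [hj]
  · intro j' _ hj
    simp [hj]
  · simp
  · intro i' _ hi
    refine Finset.sum_eq_zero fun j' _ => ?_
    by_cases hj : j' = j
    · subst hj
      rw [if_neg fun h' => hi (Fin.ext (by omega))]
    · simp [hj]
  · simp

theorem petitMul_single_right_of_add_eq_add {i j l : Fin m} (h : (i : ℕ) + j = l + m)
    (x : Fin m → K) (y : K) :
    petitMul σ a m x (Pi.single j y) l = x i * (σ ^ (i : ℕ)) y * (σ ^ (l : ℕ)) a := by
  unfold petitMul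
  rw [add_comm, Finset.sum_eq_single i, Finset.sum_eq_single j, Finset.sum_eq_zero, add_zero]
  · simp [h]
  · intro i' _
    refine Finset.sum_eq_zero fun j' _ => ?_
    by_cases hj : j' = j
    · subst hj
      rw [if_neg (by omega)]
    · simp [hj]
  · intro j' _ hj
    simp [hj]
  · simp
  · intro i' _ hi
    refine Finset.sum_eq_zero fun j' _ => ?_
    by_cases hj : j' = j
    · subst hj
      rw [if_neg fun h' => hi (Fin.ext (by omega))]
    · simp [hj]
  · simp

theorem petitMul_single_zero_left (hm : 0 < m) (c : K) (y : Fin m → K) :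
    petitMul σ a m (Pi.single ⟨0, hm⟩ c) y = c • y := by
  funext l
  rw [petitMul_single_left_of_add_eq (r := l) (by simp)]
  simp

theorem petitMul_single_zero_right (hm : 0 < m) (x : Fin m → K) (c : K) (l : Fin m) :
    petitMul σ a m x (Pi.single ⟨0, hm⟩ c) l = x l * (σ ^ (l : ℕ)) c :=
  petitMul_single_right_of_add_eq (by simp) x c

theorem smul_petitMul (c : K) (x y : Fin m → K) :
    petitMul σ a m (c • x) y = c • petitMul σ a m x y := by
  funext l
  simp only [petitMul, Pi.smul_apply, smul_eq_mul, mul_add, Finset.mul_sum, mul_ite, mul_zero,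
    mul_assoc]

/-- `t · (y t^j) = σ(y) t^{j+1}` as long as `j + 1 < m`. -/
theorem petitMul_single_one_single (hm : 1 < m) {j j' : Fin m} (h : (j : ℕ) + 1 = j') (c : K) :
    petitMul σ a m (Pi.single ⟨1, hm⟩ 1) (Pi.single j c) = Pi.single j' (σ c) := by
  funext l
  obtain ⟨l, hl⟩ := l
  rcases l with _ | l
  · rw [petitMul_single_left_of_add_eq_add (r := ⟨m - 1, by omega⟩) (by simp; omega),
      Pi.single_eq_of_ne (by rw [Ne, Fin.ext_iff]; simp; omega),
      Pi.single_eq_of_ne (by rw [Ne, Fin.ext_iff]; simp; omega)]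
    simp
  · rw [petitMul_single_left_of_add_eq (r := ⟨l, by omega⟩) (by simp; omega)]
    by_cases hlj : l = j
    · subst hlj
      have : j' = ⟨j + 1, hl⟩ := Fin.ext h.symm
      subst this
      simp
    · rw [Pi.single_eq_of_ne (by rw [Ne, Fin.ext_iff]; simpa using hlj),
        Pi.single_eq_of_ne (by rw [Ne, Fin.ext_iff]; simp; omega)]
      simp

/-- The associator `(t, c t^j, z)` vanishes as long as `j + 1 < m`. -/
theorem petitMul_single_one_assoc (hm : 1 < m) {j : Fin m} (h : (j : ℕ) + 1 < m) (c : K)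
    (z : Fin m → K) :
    petitMul σ a m (petitMul σ a m (Pi.single ⟨1, hm⟩ 1) (Pi.single j c)) z =
      petitMul σ a m (Pi.single ⟨1, hm⟩ 1) (petitMul σ a m (Pi.single j c) z) := by
  rw [petitMul_single_one_single hm (j' := ⟨j + 1, h⟩) rfl]
  funext l
  obtain ⟨l, hl⟩ := l
  have hj := j.isLt
  rcases l with _ | l
  · rw [petitMul_single_left_of_add_eq_add (r := ⟨m - 1 - j, by omega⟩) (by simp; omega),
      petitMul_single_left_of_add_eq_add (r := ⟨m - 1, by omega⟩) (by simp; omega),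
      petitMul_single_left_of_add_eq (r := ⟨m - 1 - j, by omega⟩) (by simp; omega)]
    simp [pow_succ']
  · rw [petitMul_single_left_of_add_eq (i := ⟨1, hm⟩) (r := ⟨l, by omega⟩) (by simp; omega)]
    by_cases hjl : (j : ℕ) ≤ l
    · rw [petitMul_single_left_of_add_eq (r := ⟨l - j, by omega⟩) (by simp; omega),
        petitMul_single_left_of_add_eq (r := ⟨l - j, by omega⟩) (by simp; omega)]
      simp [pow_succ']
    · rw [petitMul_single_left_of_add_eq_add (r := ⟨l + m - j, by omega⟩) (by simp; omega),
        petitMul_single_left_of_add_eq_add (r := ⟨l + m - j, by omega⟩) (by simp; omega)]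
      simp [pow_succ']

/-- If the associator `(x, t^{m-1}, t)` vanishes, then `x` lies in `K`. -/
theorem apply_eq_zero_of_petitMul_assoc (hm : 1 < m) (ha : σ a ≠ a) {x : Fin m → K}
    (h : petitMul σ a m (petitMul σ a m x (Pi.single ⟨m - 1, by omega⟩ 1))
        (Pi.single ⟨1, hm⟩ 1) =
      petitMul σ a m x (petitMul σ a m (Pi.single ⟨m - 1, by omega⟩ 1) (Pi.single ⟨1, hm⟩ 1)))
    {l : Fin m} (hl : (l : ℕ) ≠ 0) : x l = 0 := by
  have hC : petitMul σ a m (Pi.single ⟨m - 1, by omega⟩ 1) (Pi.single ⟨1, hm⟩ 1) =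
      Pi.single ⟨0, by omega⟩ a := by
    funext l
    obtain ⟨l, hl⟩ := l
    rcases l with _ | l
    · rw [petitMul_single_right_of_add_eq_add (i := ⟨m - 1, by omega⟩) (by simp; omega)]
      simp
    · rw [petitMul_single_right_of_add_eq (i := ⟨l, by omega⟩) (by simp),
        Pi.single_eq_of_ne (by rw [Ne, Fin.ext_iff]; simp; omega),
        Pi.single_eq_of_ne (by rw [Ne, Fin.ext_iff]; simp)]
      simp
  obtain ⟨l, hlm⟩ := l
  rcases l with _ | l
  · exact absurd rfl hl
  have h := congrFun h ⟨l + 1, hlm⟩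
  rw [hC, petitMul_single_zero_right,
    petitMul_single_right_of_add_eq (i := ⟨l, by omega⟩) (by simp),
    petitMul_single_right_of_add_eq_add (i := ⟨l + 1, hlm⟩) (by simp; omega)] at h
  simp only [map_one, mul_one] at h
  by_contra hx
  have h' := mul_left_cancel₀ hx h
  rw [pow_succ, AlgEquiv.mul_apply] at h'
  exact ha ((σ ^ l).injective h').symm

/-- If the associator `(k t^i, y, t)` vanishes and `i ≥ 2`, then the two top coefficients of `y`
vanish. -/
theorem top_coeff_eq_zero_of_petitMul_assoc (hm : 1 < m) (ha : σ a ≠ a) {i : Fin m}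
    (hi : 2 ≤ (i : ℕ)) {k : K} (hk : k ≠ 0) {y : Fin m → K}
    (h : petitMul σ a m (petitMul σ a m (Pi.single i k) y) (Pi.single ⟨1, hm⟩ 1) =
      petitMul σ a m (Pi.single i k) (petitMul σ a m y (Pi.single ⟨1, hm⟩ 1))) :
    y ⟨m - 1, by omega⟩ = 0 ∧ y ⟨m - 2, by omega⟩ = 0 := by
  obtain ⟨i, him⟩ := i
  obtain ⟨p, rfl⟩ : ∃ p, i = p + 2 := ⟨i - 2, by simp at hi; omega⟩
  have hσ : ∀ q : ℕ, (σ ^ q) a ≠ (σ ^ (q + 1)) a := fun q hq => by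
    rw [pow_succ, AlgEquiv.mul_apply] at hq
    exact ha ((σ ^ q).injective hq).symm
  have key : ∀ (q : ℕ) (b : K), k * (σ ^ (p + 2)) b * (σ ^ q) a =
      k * (σ ^ (p + 2)) b * (σ ^ (q + 1)) a → b = 0 := fun q b hb => by
    by_contra hb0
    refine hσ q (mul_left_cancel₀ (mul_ne_zero hk ?_) hb)
    exact (map_ne_zero_iff _ (σ ^ (p + 2)).injective).2 hb0
  constructor
  · have h := congrFun h ⟨p + 2, him⟩
    rw [petitMul_single_right_of_add_eq (i := ⟨p + 1, by omega⟩) (by simp),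
      petitMul_single_left_of_add_eq_add (r := ⟨m - 1, by omega⟩) (by simp; omega),
      petitMul_single_left_of_add_eq (r := ⟨0, by omega⟩) (by simp),
      petitMul_single_right_of_add_eq_add (i := ⟨m - 1, by omega⟩) (by simp; omega)] at h
    refine key (p + 1) _ ?_
    simpa [mul_assoc] using h
  · have h := congrFun h ⟨p + 1, by omega⟩
    rw [petitMul_single_right_of_add_eq (i := ⟨p, by omega⟩) (by simp),
      petitMul_single_left_of_add_eq_add (r := ⟨m - 2, by omega⟩) (by simp; omega),
      petitMul_single_left_of_add_eq_add (r := ⟨m - 1, by omega⟩) (by simp; omega),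
      petitMul_single_right_of_add_eq (i := ⟨m - 2, by omega⟩) (by simp; omega)] at h
    refine key p _ ?_
    simpa using h

/-- An isomorphism of Petit algebras maps `K` to `K`, through an `F`-endomorphism of `K`. -/
theorem exists_algHom_of_petitMul_equiv {σ₁ σ₂ : K ≃ₐ[F] K} {a₁ a₂ : K} (hm : 1 < m)
    (ha₂ : σ₂ a₂ ≠ a₂) (e : (Fin m → K) ≃ₗ[F] (Fin m → K))
    (he : ∀ x y, e (petitMul σ₁ a₁ m x y) = petitMul σ₂ a₂ m (e x) (e y)) :
    ∃ τ : K →ₐ[F] K, ∀ c, e (Pi.single ⟨0, by omega⟩ c) = Pi.single ⟨0, by omega⟩ (τ c) := by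
  have hm0 : 0 < m := by omega
  have h0 : ∀ c, e (Pi.single ⟨0, hm0⟩ c) =
      Pi.single ⟨0, hm0⟩ (e (Pi.single ⟨0, hm0⟩ c) ⟨0, hm0⟩) := fun c => by
    have hassoc : ∀ y z, petitMul σ₂ a₂ m (petitMul σ₂ a₂ m (e (Pi.single ⟨0, hm0⟩ c)) y) z =
        petitMul σ₂ a₂ m (e (Pi.single ⟨0, hm0⟩ c)) (petitMul σ₂ a₂ m y z) := fun y z => by
      obtain ⟨y, rfl⟩ := e.surjective y
      obtain ⟨z, rfl⟩ := e.surjective z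
      rw [← he, ← he, ← he, ← he, petitMul_single_zero_left, petitMul_single_zero_left,
        smul_petitMul]
    funext l
    by_cases hl : l = ⟨0, hm0⟩
    · subst hl
      simp
    · rw [Pi.single_eq_of_ne hl]
      exact apply_eq_zero_of_petitMul_assoc hm ha₂ (hassoc _ _)
        fun h => hl (Fin.ext (by simpa using h))
  refine ⟨AlgHom.ofLinearMap
    (LinearMap.proj (R := F) (φ := fun _ : Fin m => K) ⟨0, hm0⟩ ∘ₗ e.toLinearMap ∘ₗ
      LinearMap.single F (fun _ : Fin m => K) ⟨0, hm0⟩) ?_ ?_, fun c => ?_⟩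
  · obtain ⟨y, hy⟩ := e.surjective (Pi.single ⟨0, hm0⟩ 1)
    have h := he (Pi.single ⟨0, hm0⟩ 1) y
    rw [petitMul_single_zero_left, one_smul, h0, petitMul_single_zero_left, hy] at h
    simpa using (congrFun h ⟨0, hm0⟩).symm
  · intro c d
    have h := he (Pi.single ⟨0, hm0⟩ c) (Pi.single ⟨0, hm0⟩ d)
    rw [petitMul_single_zero_left, h0 c, petitMul_single_zero_left, ← Pi.single_smul] at h
    simpa using congrFun h ⟨0, hm0⟩
  · simpa using h0 c

/-- An isomorphism of Petit algebras cannot map `t` to a monomial `k t^i` with `i ≥ 2`. -/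
theorem not_petitMul_equiv_single_one [FiniteDimensional F K] {σ₁ σ₂ : K ≃ₐ[F] K} {a₁ a₂ : K}
    (hm : 1 < m) (ha₂ : σ₂ a₂ ≠ a₂) (e : (Fin m → K) ≃ₗ[F] (Fin m → K))
    (he : ∀ x y, e (petitMul σ₁ a₁ m x y) = petitMul σ₂ a₂ m (e x) (e y))
    {i : Fin m} (hi : 2 ≤ (i : ℕ)) (k : K) : e (Pi.single ⟨1, hm⟩ 1) ≠ Pi.single i k := by
  intro hek
  have hk : k ≠ 0 := by
    rintro rfl
    rw [Pi.single_zero, map_eq_zero_iff e e.injective, Pi.single_eq_zero_iff] at hek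
    exact one_ne_zero hek
  let f : (Fin m → K) →ₗ[F] K × K :=
    ((LinearMap.proj (R := F) (φ := fun _ : Fin m => K) ⟨m - 1, by omega⟩).prod
      (LinearMap.proj (R := F) (φ := fun _ : Fin m => K) ⟨m - 2, by omega⟩)) ∘ₗ e.toLinearMap
  have hf : ∀ (j : Fin m) (c : K), j ≠ ⟨m - 1, by omega⟩ → f (Pi.single j c) = 0 := by
    intro j c hj
    have hj' : (j : ℕ) + 1 < m := by
      have := j.isLt
      rw [Ne, Fin.ext_iff] at hj
      simp only at hj
      omega
    have h := congrArg e
      (petitMul_single_one_assoc (σ := σ₁) (a := a₁) hm hj' c (e.symm (Pi.single ⟨1, hm⟩ 1)))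
    rw [he, he, he, he, hek, e.apply_symm_apply] at h
    obtain ⟨h₁, h₂⟩ := top_coeff_eq_zero_of_petitMul_assoc hm ha₂ hi hk h
    exact Prod.ext h₁ h₂
  have hsurj : Function.Surjective
      (f ∘ₗ LinearMap.single F (fun _ : Fin m => K) ⟨m - 1, by omega⟩) := by
    rintro ⟨u, v⟩
    obtain ⟨y, hy⟩ := e.surjective (Pi.single ⟨m - 1, by omega⟩ u + Pi.single ⟨m - 2, by omega⟩ v)
    have hne : (⟨m - 1, by omega⟩ : Fin m) ≠ ⟨m - 2, by omega⟩ := by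
      rw [Ne, Fin.ext_iff]
      simp only
      omega
    have hfy : f y = (u, v) := by
      simp [f, hy, hne, hne.symm]
    refine ⟨y ⟨m - 1, by omega⟩, ?_⟩
    rw [← hfy]
    conv_rhs => rw [← Finset.univ_sum_single y, map_sum]
    rw [Finset.sum_eq_single ⟨m - 1, by omega⟩ (fun j _ hj => hf j _ hj) (by simp)]
    simp
  have h := LinearMap.finrank_le_finrank_of_surjective hsurj
  rw [Module.finrank_prod] at h
  have := Module.finrank_pos (R := F) (M := K)
  omega

/-- If an isomorphism of Petit algebras restricts on `K` to an automorphism commuting with `σ₂`,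
then `σ₁ = σ₂ ^ i` for every exponent `i` occurring in the image of `t`. -/
theorem eq_pow_of_petitMul_equiv {σ₁ σ₂ : K ≃ₐ[F] K} {a₁ a₂ : K} (hm : 1 < m)
    (e : (Fin m → K) ≃ₗ[F] (Fin m → K))
    (he : ∀ x y, e (petitMul σ₁ a₁ m x y) = petitMul σ₂ a₂ m (e x) (e y))
    {τ : K ≃ₐ[F] K} (hτσ : Commute τ σ₂)
    (hτ : ∀ c, e (Pi.single ⟨0, by omega⟩ c) = Pi.single ⟨0, by omega⟩ (τ c))
    {i : Fin m} (hi : e (Pi.single ⟨1, hm⟩ 1) i ≠ 0) : σ₁ = σ₂ ^ (i : ℕ) := by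
  have hmul : τ * σ₁ = τ * σ₂ ^ (i : ℕ) := by
    rw [(hτσ.pow_right (i : ℕ)).eq]
    ext c
    have h₁ := he (Pi.single ⟨1, hm⟩ 1) (Pi.single ⟨0, by omega⟩ c)
    have h₂ := he (Pi.single ⟨0, by omega⟩ (σ₁ c)) (Pi.single ⟨1, hm⟩ 1)
    rw [petitMul_single_one_single hm (j' := ⟨1, hm⟩) rfl] at h₁
    rw [petitMul_single_zero_left, ← Pi.single_smul, smul_eq_mul, mul_one, h₁, hτ, hτ,
      petitMul_single_zero_left] at h₂
    have h := congrFun h₂ i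
    rw [petitMul_single_zero_right, Pi.smul_apply, smul_eq_mul, mul_comm] at h
    exact (mul_right_cancel₀ hi h).symm
  exact mul_left_cancel hmul

end petitMul

theorem apply_ne_self_of_forall_mem_zpowers {F K : Type*} [Field F] [Field K] [Algebra F K]
    [IsGalois F K] [FiniteDimensional F K] {σ : K ≃ₐ[F] K}
    (hσ : ∀ τ : K ≃ₐ[F] K, τ ∈ Subgroup.zpowers σ) {a : K}
    (ha : a ∉ Set.range (algebraMap F K)) : σ a ≠ a := by
  intro h
  refine ha ((IsGalois.mem_range_algebraMap_iff_fixed a).2 fun τ => ?_)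
  have hle : Subgroup.zpowers σ ≤ MulAction.stabilizer (K ≃ₐ[F] K) a :=
    Subgroup.zpowers_le.2 h
  exact hle (hσ τ)

/-- Let `K/F` be a cyclic Galois field extension of degree
`n ≥ 3` and `m ≥ 2` with `n ≥ m - 1`. Then `Gal(K/F)` has exactly `φ(n)`
generators, and for any family `(a_σ)` of elements of `K ∖ F` indexed by the
generators `σ`, the Petit algebras `S_{t^m - a_σ}` (formed in `K[t;σ]`) are
pairwise non-isomorphic `F`-algebras. -/
theorem stmt_1 {F K : Type*} [Field F] [Field K] [Algebra F K]
    [IsGalois F K] [FiniteDimensional F K] (hcyc : IsCyclic (K ≃ₐ[F] K))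
    (n m : ℕ) (hdeg : Module.finrank F K = n) (hn : 3 ≤ n) (hm : 2 ≤ m) (hnm : m - 1 ≤ n) :
    Nat.card {σ : K ≃ₐ[F] K // ∀ τ : K ≃ₐ[F] K, τ ∈ Subgroup.zpowers σ} = Nat.totient n ∧
    ∀ a : (K ≃ₐ[F] K) → K,
      (∀ σ : K ≃ₐ[F] K, (∀ τ : K ≃ₐ[F] K, τ ∈ Subgroup.zpowers σ) →
        a σ ∉ Set.range (algebraMap F K)) →
      ∀ σ₁ σ₂ : K ≃ₐ[F] K,
        (∀ τ : K ≃ₐ[F] K, τ ∈ Subgroup.zpowers σ₁) →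
        (∀ τ : K ≃ₐ[F] K, τ ∈ Subgroup.zpowers σ₂) →
        σ₁ ≠ σ₂ → ¬ PetitIso σ₁ σ₂ (a σ₁) (a σ₂) m := by
  have hcard : Nat.card (K ≃ₐ[F] K) = n := by rw [IsGalois.card_aut_eq_finrank, hdeg]
  have hord : ∀ σ : K ≃ₐ[F] K, (∀ τ : K ≃ₐ[F] K, τ ∈ Subgroup.zpowers σ) → orderOf σ = n :=
    fun σ hσ => by rw [orderOf_eq_card_of_forall_mem_zpowers hσ, hcard]
  constructor
  · classical
    have h := IsCyclic.card_orderOf_eq_totient (α := K ≃ₐ[F] K) (d := n)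
      (by rw [← Nat.card_eq_fintype_card, hcard])
    rw [← h, ← Fintype.card_subtype, ← Nat.card_eq_fintype_card]
    refine Nat.card_congr (Equiv.subtypeEquivRight fun σ => ⟨hord σ, fun h τ => ?_⟩)
    rw [Subgroup.eq_top_of_card_eq (Subgroup.zpowers σ) (by rw [Nat.card_zpowers, h, hcard])]
    exact Subgroup.mem_top τ
  · rintro a ha σ₁ σ₂ h₁ h₂ hne ⟨e, he⟩
    have hm' : 1 < m := hm
    have ha₂ := apply_ne_self_of_forall_mem_zpowers h₂ (ha σ₂ h₂)
    obtain ⟨τ, hτ⟩ := exists_algHom_of_petitMul_equiv hm' ha₂ e he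
    have hcomm : Commute (AlgEquiv.ofBijective τ τ.bijective) σ₂ :=
      hcyc.isMulCommutative.is_comm.comm _ _
    have hpow : ∀ i : Fin m, e (Pi.single ⟨1, hm'⟩ 1) i ≠ 0 → σ₁ = σ₂ ^ (i : ℕ) := fun i hi =>
      eq_pow_of_petitMul_equiv hm' e he hcomm hτ hi
    have hσ₁ : σ₁ ≠ 1 := by
      rintro rfl
      have := hord 1 h₁
      rw [orderOf_one] at this
      omega
    have hlt : ∀ i : Fin m, e (Pi.single ⟨1, hm'⟩ 1) i ≠ 0 → 2 ≤ (i : ℕ) ∧ (i : ℕ) < n := by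
      intro i hi
      have h := hpow i hi
      have hi0 : (i : ℕ) ≠ 0 := fun h0 => hσ₁ (by rw [h, h0, pow_zero])
      have hi1 : (i : ℕ) ≠ 1 := fun h1 => hne (by rw [h, h1, pow_one])
      have hin : (i : ℕ) ≠ n := fun h' => hσ₁ (by rw [h, h', ← hord σ₂ h₂, pow_orderOf_eq_one])
      omega
    obtain ⟨i, hi⟩ : ∃ i, e (Pi.single ⟨1, hm'⟩ 1) i ≠ 0 := by
      by_contra! h
      have h0 : e (Pi.single ⟨1, hm'⟩ 1) = 0 := funext h
      rw [map_eq_zero_iff e e.injective, Pi.single_eq_zero_iff] at h0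
      exact one_ne_zero h0
    refine not_petitMul_equiv_single_one hm' ha₂ e he (hlt i hi).1
      (e (Pi.single ⟨1, hm'⟩ 1) i) (funext fun j => ?_)
    by_cases hj : j = i
    · subst hj
      simp
    · rw [Pi.single_eq_of_ne hj]
      by_contra hj0
      refine hj (Fin.ext (pow_injOn_Iio_orderOf (x := σ₂) ?_ ?_ ?_))
      · simpa [hord σ₂ h₂] using (hlt j hj0).2
      · simpa [hord σ₂ h₂] using (hlt i hi).2
      · simp only [← hpow j hj0, ← hpow i hi]
end

section
/- Let K/F be a cyclic Galois field extension of degree m ≥ 2 with Gal(K/F) = ⟨σ⟩, and let a ∈ K be such that a does not lie in any proper subfield of K containing F (equivalently, F(a) = K). Then the nonassociative cyclic algebra (K/F, σ, a) is a division algebra. -/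
/-- Left multiplication by `t` on `K[t;σ]/K[t;σ](t^m - a)`, as a `σ`-semilinear map. -/
noncomputable def petitShift {F K : Type*} [Field F] [Field K] [Algebra F K]
    (σ : K ≃ₐ[F] K) (a : K) (m : ℕ) :
    (Fin m → K) →ₛₗ[(σ : K →+* K)] (Fin m → K) where
  toFun y l := if (l : ℕ) = 0 then σ (y ⟨m - 1, by have := l.2; omega⟩) * a
    else σ (y ⟨l - 1, by have := l.2; omega⟩)
  map_add' y z := by
    ext l
    simp only [Pi.add_apply, map_add]
    split_ifs <;> ring
  map_smul' c y := by
    ext l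
    simp only [Pi.smul_apply, smul_eq_mul, map_mul, RingHom.coe_coe]
    split_ifs <;> ring

section

variable {F K : Type*} [Field F] [Field K] [Algebra F K] (σ : K ≃ₐ[F] K) (a : K) {m : ℕ}

lemma petitShift_iterate_apply (y : Fin m → K) (i : ℕ) (j l : Fin m) :
    (i + (j : ℕ) = l → (petitShift σ a m)^[i] y l = (σ ^ i) (y j)) ∧
    (i + (j : ℕ) = l + m →
      (petitShift σ a m)^[i] y l = (σ ^ i) (y j) * (σ ^ (l : ℕ)) a) := by
  induction i generalizing l with
  | zero =>
    refine ⟨fun h ↦ ?_, fun h ↦ ?_⟩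
    · obtain rfl : j = l := Fin.ext (by omega)
      simp
    · have := j.2
      omega
  | succ i ih =>
    have hj := j.2
    have hl := l.2
    simp only [Function.iterate_succ_apply']
    refine ⟨fun h ↦ ?_, fun h ↦ ?_⟩
    · have hl0 : (l : ℕ) ≠ 0 := by omega
      simp only [petitShift, LinearMap.coe_mk, AddHom.coe_mk, if_neg hl0]
      erw [(ih ⟨l - 1, by omega⟩).1 (by simp only; omega)]
      rw [pow_succ', AlgEquiv.mul_apply]
    · by_cases hl0 : (l : ℕ) = 0
      · simp only [petitShift, LinearMap.coe_mk, AddHom.coe_mk, if_pos hl0]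
        erw [(ih ⟨m - 1, by omega⟩).1 (by simp only; omega)]
        rw [pow_succ', AlgEquiv.mul_apply, hl0, pow_zero, AlgEquiv.one_apply]
      · simp only [petitShift, LinearMap.coe_mk, AddHom.coe_mk, if_neg hl0]
        erw [(ih ⟨l - 1, by omega⟩).2 (by simp only; omega)]
        obtain ⟨k, hk⟩ := Nat.exists_eq_succ_of_ne_zero hl0
        simp only [hk, map_mul, Nat.succ_eq_add_one, Nat.add_sub_cancel]
        rw [pow_succ', pow_succ', AlgEquiv.mul_apply, AlgEquiv.mul_apply]

lemma petitMul_eq_sum (x y : Fin m → K) :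
    petitMul σ a m x y = ∑ i : Fin m, x i • (petitShift σ a m)^[(i : ℕ)] y := by
  ext l
  rw [petitMul, ← Finset.sum_add_distrib, Finset.sum_apply]
  refine Finset.sum_congr rfl fun i _ ↦ ?_
  have hi := i.2
  have hl := l.2
  rw [Pi.smul_apply, smul_eq_mul]
  by_cases h : (i : ℕ) ≤ l
  · have hj : (i : ℕ) + ((⟨l - i, by omega⟩ : Fin m) : ℕ) = l := by simp only; omega
    rw [(petitShift_iterate_apply σ a y i _ l).1 hj,
      Finset.sum_eq_single_of_mem (⟨l - i, by omega⟩ : Fin m) (Finset.mem_univ _)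
        fun b _ hb ↦ if_neg fun hbl ↦ hb (Fin.ext (by omega)),
      if_pos hj, Finset.sum_eq_zero fun b _ ↦ if_neg (by omega), add_zero]
  · have hj : (i : ℕ) + ((⟨l + m - i, by omega⟩ : Fin m) : ℕ) = l + m := by simp only; omega
    rw [(petitShift_iterate_apply σ a y i _ l).2 hj,
      Finset.sum_eq_zero fun b _ ↦ if_neg (by omega),
      Finset.sum_eq_single_of_mem (⟨l + m - i, by omega⟩ : Fin m) (Finset.mem_univ _)
        fun b _ hb ↦ if_neg fun hbl ↦ hb (Fin.ext (by omega)),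
      if_pos hj, zero_add, mul_assoc]

lemma petitShift_single_of_lt (l : Fin m) (h : (l : ℕ) + 1 < m) :
    petitShift σ a m (Pi.single l 1) = Pi.single ⟨l + 1, h⟩ 1 := by
  ext k
  simp only [petitShift, LinearMap.coe_mk, AddHom.coe_mk, Pi.single_apply, Fin.ext_iff]
  have := k.2
  split_ifs <;> first | omega | simp

lemma petitShift_single_last (h : 0 < m) :
    petitShift σ a m (Pi.single ⟨m - 1, by omega⟩ 1) = a • Pi.single ⟨0, h⟩ 1 := by
  ext k
  simp only [petitShift, LinearMap.coe_mk, AddHom.coe_mk, Pi.single_apply, Fin.ext_iff,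
    Pi.smul_apply]
  have := k.2
  split_ifs <;> first | omega | simp

variable {σ a}

/-- A submodule stable under a diagonal operator with distinct eigenvalues contains the
coordinate vectors supporting its elements. -/
lemma single_mem_of_diagonal_stable {ι : Type*} [Fintype ι] [DecidableEq ι] {c : ι → K}
    (hc : Function.Injective c) {W : Submodule K (ι → K)} (hW : ∀ w ∈ W, c * w ∈ W)
    {w : ι → K} (hw : w ∈ W) {l : ι} (hl : w l ≠ 0) : Pi.single l 1 ∈ W := by
  have key (s : Finset ι) : (fun k ↦ (∏ j ∈ s, (c k - c j)) * w k) ∈ W := by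
    induction s using Finset.induction_on with
    | empty => simpa using hw
    | insert b s hb ih =>
      convert W.sub_mem (hW _ ih) (W.smul_mem (c b) ih) using 1
      ext k
      simp only [Finset.prod_insert hb, Pi.sub_apply, Pi.mul_apply, Pi.smul_apply, smul_eq_mul]
      ring
  have hne : (∏ j ∈ Finset.univ.erase l, (c l - c j)) * w l ≠ 0 :=
    mul_ne_zero (Finset.prod_ne_zero_iff.2 fun j hj ↦
      sub_ne_zero.2 fun h ↦ (Finset.ne_of_mem_erase hj) (hc h).symm) hl
  refine (W.smul_mem_iff hne).1 ?_
  convert key (Finset.univ.erase l) using 1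
  ext k
  by_cases hk : k = l
  · subst hk
    simp
  · have h0 : ∏ j ∈ Finset.univ.erase l, (c k - c j) = 0 :=
      Finset.prod_eq_zero (Finset.mem_erase.2 ⟨hk, Finset.mem_univ k⟩) (sub_self (c k))
    simp [hk, h0]

/-- `K[t;σ]/K[t;σ](t^m - a)` is a simple left `K[t;σ]`-module when `σ^m = 1`, `a ≠ 0` and the
conjugates `σ^i(a)`, `i < m`, are distinct. -/
lemma eq_top_of_petitShift_stable (hσ : σ ^ m = 1) (ha : a ≠ 0)
    (hinj : Function.Injective fun l : Fin m ↦ (σ ^ (l : ℕ)) a)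
    {W : Submodule K (Fin m → K)} (hW : ∀ w ∈ W, petitShift σ a m w ∈ W)
    {w : Fin m → K} (hw : w ∈ W) (hw0 : w ≠ 0) : W = ⊤ := by
  obtain ⟨l, hl⟩ := Function.ne_iff.1 hw0
  have hiter (i : ℕ) : ∀ w ∈ W, (petitShift σ a m)^[i] w ∈ W := by
    induction i with
    | zero => exact fun w hw ↦ hw
    | succ i ih => exact fun w hw ↦ ih _ (hW w hw)
  have hdiag : ∀ w ∈ W, (fun l : Fin m ↦ (σ ^ (l : ℕ)) a) * w ∈ W := fun w hw ↦ by
    convert hiter m w hw using 1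
    ext k
    rw [(petitShift_iterate_apply σ a w m k k).2 (add_comm _ _), hσ]
    simp [mul_comm]
  have hl : Pi.single l 1 ∈ W := single_mem_of_diagonal_stable hinj hdiag hw hl
  have up (l k : Fin m) (hlk : l ≤ k) (hl : Pi.single l 1 ∈ W) : Pi.single k 1 ∈ W := by
    obtain ⟨k, hk⟩ := k
    replace hlk : (l : ℕ) ≤ k := hlk
    induction k, hlk using Nat.le_induction with
    | base => exact hl
    | succ k _ ih =>
      rw [← petitShift_single_of_lt σ a ⟨k, by omega⟩ hk]
      exact hW _ (ih _)
  have hm : 0 < m := l.pos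
  have h0 : Pi.single ⟨0, hm⟩ 1 ∈ W := by
    have := hW _ (up l ⟨m - 1, by omega⟩ (Fin.le_def.2 (by have := l.2; simp only; omega)) hl)
    rw [petitShift_single_last σ a hm] at this
    exact (W.smul_mem_iff ha).1 this
  refine eq_top_iff.2 fun v _ ↦ ?_
  rw [pi_eq_sum_univ' v]
  refine W.sum_mem fun k _ ↦ W.smul_mem _ ?_
  exact up _ k (Fin.le_def.2 (Nat.zero_le _)) h0

lemma conjugates_injective [FiniteDimensional F K] [IsGalois F K]
    (hgen : ∀ τ : K ≃ₐ[F] K, τ ∈ Subgroup.zpowers σ)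
    (ha : IntermediateField.adjoin F {a} = ⊤) :
    Function.Injective fun l : Fin (Module.finrank F K) ↦ (σ ^ (l : ℕ)) a := by
  intro i j hij
  have hord : orderOf σ = Module.finrank F K := by
    rw [orderOf_eq_card_of_forall_mem_zpowers hgen, IsGalois.card_aut_eq_finrank]
  have hpow : σ ^ (i : ℕ) = σ ^ (j : ℕ) := by
    have := IntermediateField.algHom_ext_of_eq_adjoin F ha.symm
      (φ₁ := ((σ ^ (i : ℕ) : K ≃ₐ[F] K) : K →ₐ[F] K).comp (⊤ : IntermediateField F K).val)
      (φ₂ := ((σ ^ (j : ℕ) : K ≃ₐ[F] K) : K →ₐ[F] K).comp (⊤ : IntermediateField F K).val)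
      (by rintro x rfl; exact hij)
    ext z
    exact DFunLike.congr_fun this (⟨z, trivial⟩ : (⊤ : IntermediateField F K))
  exact Fin.ext (pow_injOn_Iio_orderOf (by simp [hord]) (by simp [hord]) hpow)

end

/-- Let `K/F` be a cyclic Galois field extension of degree
`m ≥ 2` with `Gal(K/F) = ⟨σ⟩`, and let `a ∈ K` be an element that lies in no
proper subfield of `K` containing `F` (equivalently, `F(a) = K`). Then the
nonassociative cyclic algebra `(K/F, σ, a)` is a division algebra (it has no
zero divisors). -/
theorem stmt_5 {F K : Type*} [Field F] [Field K] [Algebra F K]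
    [IsGalois F K]
    (m : ℕ) (hm : 2 ≤ m) (hdeg : Module.finrank F K = m)
    (σ : K ≃ₐ[F] K)
    (hgen : ∀ τ : K ≃ₐ[F] K, τ ∈ Subgroup.zpowers σ)
    (a : K) (ha : IntermediateField.adjoin F {a} = ⊤) :
    ∀ x y : Fin m → K, petitMul σ a m x y = 0 → x = 0 ∨ y = 0 := by
  intro x y hxy
  classical
  by_contra! h
  obtain ⟨hx, hy⟩ := h
  have : FiniteDimensional F K := Module.finite_of_finrank_pos (by omega)
  have hinj : Function.Injective fun l : Fin m ↦ (σ ^ (l : ℕ)) a := by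
    subst hdeg
    exact conjugates_injective hgen ha
  have ha0 : a ≠ 0 := by
    rintro rfl
    have := @hinj ⟨0, by omega⟩ ⟨1, by omega⟩ (by simp)
    simp at this
  have hσ : σ ^ m = 1 := by
    rw [← hdeg, ← IsGalois.card_aut_eq_finrank, pow_card_eq_one']
  obtain ⟨j, hj⟩ := Function.ne_iff.1 hx
  obtain ⟨d, hd, hmax⟩ := Finset.exists_max_image (Finset.univ.filter fun i ↦ x i ≠ 0) id
    ⟨j, by simpa using hj⟩
  simp only [Finset.mem_filter, Finset.mem_univ, true_and, id] at hd hmax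
  set T := petitShift σ a m
  let W : Submodule K (Fin m → K) :=
    Submodule.span K (Set.range fun i : Fin d ↦ T^[(i : ℕ)] y)
  have hlt (i : ℕ) (hi : i < d) : T^[i] y ∈ W := Submodule.subset_span ⟨⟨i, hi⟩, rfl⟩
  have hdW : T^[(d : ℕ)] y ∈ W := by
    rw [petitMul_eq_sum, ← Finset.add_sum_erase _ _ (Finset.mem_univ d)] at hxy
    refine (W.smul_mem_iff hd).1 ?_
    rw [eq_neg_of_add_eq_zero_left hxy]
    refine W.neg_mem (W.sum_mem fun i hi ↦ ?_)
    by_cases hxi : x i = 0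
    · simp [hxi]
    · exact W.smul_mem _ (hlt i ((hmax i hxi).lt_of_ne (Finset.ne_of_mem_erase (a := d) hi)))
  have hW : ∀ w ∈ W, T w ∈ W := by
    change W ≤ W.comap T
    refine Submodule.span_le.2 ?_
    rintro _ ⟨i, rfl⟩
    change T (T^[(i : ℕ)] y) ∈ W
    rw [← Function.iterate_succ_apply' T]
    rcases Nat.lt_or_ge (i + 1) d with h | h
    · exact hlt _ h
    · rwa [show (i : ℕ).succ = d by have := i.2; omega]
  have hyW : y ∈ W := by
    rcases Nat.eq_zero_or_pos d with h | h
    · rwa [h] at hdW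
    · exact hlt 0 h
  have htop := eq_top_of_petitShift_stable hσ ha0 hinj hW hyW hy
  have hrank : Module.finrank K W ≤ d := by
    simpa [Set.finrank] using finrank_range_le_card (R := K) fun i : Fin d ↦ T^[(i : ℕ)] y
  rw [htop, finrank_top, Module.finrank_fin_fun] at hrank
  exact absurd d.2 (by omega)
end

section
/- Let K/F be a cyclic Galois field extension of degree n ≥ 3 and let σ₁ and σ₂ be distinct generators of Gal(K/F), so that σ₁ = σ₂^j for some j with 1 < j < n and gcd(j,n) = 1. Let m ≥ 2 with n ≥ m−1, let f ∈ K[t;σ₁] and g ∈ K[t;σ₂] be monic of degree m, neither of them right-invariant, and let H : S_f → S_g be an F-algebra isomorphism between the (proper nonassociative) Petit algebras. Then H maps constant polynomials to constant polynomials, the induced map on K is an element τ ∈ Gal(K/F), and H(t) = k t^j for some k ∈ K^× (in particular j ≤ m−1). -/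
/-- Multiplication of the twisted polynomial ring `K[t;σ]`, on the space
`ℕ →₀ K` of finitely supported coefficient sequences: determined by
`t·c = σ(c)·t`, i.e. `(a t^i)(b t^j) = a σ^i(b) t^{i+j}`. -/
noncomputable def tmul {F K : Type*} [Field F] [Field K] [Algebra F K]
    (σ : K ≃ₐ[F] K) (p q : ℕ →₀ K) : ℕ →₀ K :=
  p.sum fun i a => q.sum fun j b => Finsupp.single (i + j) (a * (σ ^ i) b)

/-- The twisted polynomial `p` has degree `< m`. -/
def DegLt {K : Type*} [Field K] (m : ℕ) (p : ℕ →₀ K) : Prop :=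
  ∀ i : ℕ, m ≤ i → p i = 0

/-- The twisted polynomial `p` is monic of degree `m`. -/
def TMonic {K : Type*} [Field K] (m : ℕ) (p : ℕ →₀ K) : Prop :=
  p m = 1 ∧ ∀ i : ℕ, m < i → p i = 0

/-- `f` is right-invariant: the left ideal `K[t;σ]f` is a two-sided ideal,
i.e. it is closed under right multiplication. -/
def RightInvariant {F K : Type*} [Field F] [Field K] [Algebra F K]
    (σ : K ≃ₐ[F] K) (f : ℕ →₀ K) : Prop :=
  ∀ q g : ℕ →₀ K, ∃ q' : ℕ →₀ K, tmul σ (tmul σ q f) g = tmul σ q' f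

/-- `mul` is the multiplication of the Petit algebra
`S_f = K[t;σ]/K[t;σ]f` on polynomials of degree `< m`:
`mul p q` is the remainder of `p·q` after right division by `f`. -/
def IsPetitMul {F K : Type*} [Field F] [Field K] [Algebra F K]
    (σ : K ≃ₐ[F] K) (m : ℕ) (f : ℕ →₀ K)
    (mul : (ℕ →₀ K) → (ℕ →₀ K) → (ℕ →₀ K)) : Prop :=
  ∀ p q : ℕ →₀ K, DegLt m p → DegLt m q →
    DegLt m (mul p q) ∧ ∃ s : ℕ →₀ K, tmul σ p q = tmul σ s f + mul p q

section TwistedPolynomials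

variable {F K : Type*} [Field F] [Field K] [Algebra F K] (σ : K ≃ₐ[F] K)

theorem tmul_zero_left (q : ℕ →₀ K) : tmul σ 0 q = 0 := by
  simp [tmul]

theorem tmul_zero_right (p : ℕ →₀ K) : tmul σ p 0 = 0 := by
  simp [tmul]

theorem tmul_add_left (p p' q : ℕ →₀ K) : tmul σ (p + p') q = tmul σ p q + tmul σ p' q := by
  refine Finsupp.sum_add_index' (fun i => by simp) fun i a b => ?_
  simp [add_mul, Finsupp.sum_add]

theorem tmul_add_right (p q q' : ℕ →₀ K) : tmul σ p (q + q') = tmul σ p q + tmul σ p q' := by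
  simp only [tmul, ← Finsupp.sum_add]
  refine Finsupp.sum_congr fun i _ => ?_
  exact Finsupp.sum_add_index' (fun j => by simp) fun j a b => by simp [mul_add]

theorem tmul_neg_left (p q : ℕ →₀ K) : tmul σ (-p) q = -tmul σ p q := by
  rw [eq_neg_iff_add_eq_zero, ← tmul_add_left, neg_add_cancel, tmul_zero_left]

theorem tmul_sub_left (p p' q : ℕ →₀ K) : tmul σ (p - p') q = tmul σ p q - tmul σ p' q := by
  rw [sub_eq_add_neg, tmul_add_left, tmul_neg_left, ← sub_eq_add_neg]

theorem tmul_single_single (i j : ℕ) (a b : K) :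
    tmul σ (Finsupp.single i a) (Finsupp.single j b) =
      Finsupp.single (i + j) (a * (σ ^ i) b) := by
  simp [tmul]

theorem tmul_assoc (p q r : ℕ →₀ K) : tmul σ (tmul σ p q) r = tmul σ p (tmul σ q r) := by
  induction p using Finsupp.induction_linear with
  | zero => simp only [tmul_zero_left]
  | add p p' hp hp' => simp only [tmul_add_left, hp, hp']
  | single i a =>
    induction q using Finsupp.induction_linear with
    | zero => simp only [tmul_zero_left, tmul_zero_right]
    | add q q' hq hq' => simp only [tmul_add_left, tmul_add_right, hq, hq']
    | single j b =>
      induction r using Finsupp.induction_linear with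
      | zero => simp only [tmul_zero_right]
      | add r r' hr hr' => simp only [tmul_add_right, hr, hr']
      | single k c =>
        simp only [tmul_single_single, map_mul, pow_add, AlgEquiv.mul_apply, mul_assoc, add_assoc]

theorem tmul_apply (p q : ℕ →₀ K) (N : ℕ) :
    tmul σ p q N = ∑ x ∈ Finset.HasAntidiagonal.antidiagonal N, p x.1 * (σ ^ x.1) (q x.2) := by
  induction p using Finsupp.induction_linear with
  | zero => simp [tmul_zero_left]
  | add p p' hp hp' => simp [tmul_add_left, hp, hp', add_mul, Finset.sum_add_distrib]
  | single i a =>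
    induction q using Finsupp.induction_linear with
    | zero => simp [tmul_zero_right]
    | add q q' hq hq' => simp [tmul_add_right, hq, hq', mul_add, Finset.sum_add_distrib]
    | single j b =>
      rw [tmul_single_single, Finsupp.single_apply]
      split_ifs with h
      · rw [Finset.sum_eq_single (i, j)]
        · simp
        · rintro ⟨x, y⟩ - hxy
          by_cases hx : i = x
          · have hy : j ≠ y := fun hy => hxy (by rw [hx, hy])
            simp [Finsupp.single_eq_of_ne' hy]
          · simp [Finsupp.single_eq_of_ne' hx]
        · intro h'
          exact absurd (Finset.HasAntidiagonal.mem_antidiagonal.2 h) h'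
      · refine (Finset.sum_eq_zero ?_).symm
        rintro ⟨x, y⟩ hxy
        rw [Finset.HasAntidiagonal.mem_antidiagonal] at hxy
        by_cases hx : i = x
        · have hy : j ≠ y := fun hy => h (by rw [hx, hy]; exact hxy)
          simp [Finsupp.single_eq_of_ne' hy]
        · simp [Finsupp.single_eq_of_ne' hx]

theorem tmul_single_zero_left_apply (c : K) (q : ℕ →₀ K) (N : ℕ) :
    tmul σ (Finsupp.single 0 c) q N = c * q N := by
  rw [tmul_apply, Finset.sum_eq_single (0, N)]
  · simp
  · rintro ⟨x, y⟩ hxy hne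
    rw [Finset.HasAntidiagonal.mem_antidiagonal] at hxy
    have hx : 0 ≠ x := by
      rintro rfl
      exact hne (by simpa using hxy)
    simp [Finsupp.single_eq_of_ne' hx]
  · simp

theorem tmul_single_zero_right_apply (p : ℕ →₀ K) (c : K) (N : ℕ) :
    tmul σ p (Finsupp.single 0 c) N = p N * (σ ^ N) c := by
  rw [tmul_apply, Finset.sum_eq_single (N, 0)]
  · simp
  · rintro ⟨x, y⟩ hxy hne
    rw [Finset.HasAntidiagonal.mem_antidiagonal] at hxy
    have hy : 0 ≠ y := by
      rintro rfl
      exact hne (by simpa using hxy)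
    simp [Finsupp.single_eq_of_ne' hy]
  · simp

theorem tmul_apply_of_degLt {a b : ℕ} {p q : ℕ →₀ K} (hp : DegLt (a + 1) p)
    (hq : DegLt (b + 1) q) : tmul σ p q (a + b) = p a * (σ ^ a) (q b) := by
  rw [tmul_apply, Finset.sum_eq_single (a, b)]
  · rintro ⟨x, y⟩ hxy hne
    rw [Finset.HasAntidiagonal.mem_antidiagonal] at hxy
    rcases lt_trichotomy x a with h | h | h
    · rw [hq y (by grind)]; simp
    · exact absurd (by grind) hne
    · rw [hp x (by grind)]; simp
  · simp

theorem degLt_tmul {a b : ℕ} {p q : ℕ →₀ K} (hp : DegLt (a + 1) p) (hq : DegLt (b + 1) q) :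
    DegLt (a + b + 1) (tmul σ p q) := by
  intro N hN
  rw [tmul_apply]
  refine Finset.sum_eq_zero ?_
  rintro ⟨x, y⟩ hxy
  rw [Finset.HasAntidiagonal.mem_antidiagonal] at hxy
  rcases le_or_gt x a with h | h
  · rw [hq y (by grind)]; simp
  · rw [hp x (by grind)]; simp

theorem degLt_single {m i : ℕ} (h : i < m) (c : K) : DegLt m (Finsupp.single i c) :=
  fun k hk => Finsupp.single_eq_of_ne' (by omega)

theorem DegLt.sub {m : ℕ} {p q : ℕ →₀ K} (hp : DegLt m p) (hq : DegLt m q) :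
    DegLt m (p - q) :=
  fun i hi => by simp [hp i hi, hq i hi]

theorem TMonic.degLt {m : ℕ} {f : ℕ →₀ K} (hf : TMonic m f) : DegLt (m + 1) f :=
  fun i hi => hf.2 i hi

/-- A twisted polynomial with a nonzero coefficient in degree `i` has a leading coefficient, in
degree at least `i`. -/
theorem exists_leading_of_apply_ne_zero {p : ℕ →₀ K} {i : ℕ} (hi : p i ≠ 0) :
    ∃ d, i ≤ d ∧ p d ≠ 0 ∧ DegLt (d + 1) p := by
  have hs : p.support.Nonempty := ⟨i, Finsupp.mem_support_iff.2 hi⟩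
  refine ⟨p.support.max' hs, Finset.le_max' _ _ (Finsupp.mem_support_iff.2 hi),
    Finsupp.mem_support_iff.1 (Finset.max'_mem _ hs), fun k hk => ?_⟩
  by_contra hne
  have := Finset.le_max' _ _ (Finsupp.mem_support_iff.2 hne)
  omega

theorem eq_zero_of_degLt_tmul {m : ℕ} {f s : ℕ →₀ K} (hf : TMonic m f)
    (h : DegLt m (tmul σ s f)) : s = 0 := by
  by_contra hs
  obtain ⟨i, hi⟩ := Finsupp.ne_iff.1 hs
  obtain ⟨d, -, hd, hdeg⟩ := exists_leading_of_apply_ne_zero hi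
  have := tmul_apply_of_degLt σ hdeg hf.degLt
  rw [h _ (by omega), hf.1, map_one, mul_one] at this
  exact hd this.symm

theorem divMod_unique {m : ℕ} {f s s' r r' : ℕ →₀ K} (hf : TMonic m f) (hr : DegLt m r)
    (hr' : DegLt m r') (h : tmul σ s f + r = tmul σ s' f + r') : s = s' ∧ r = r' := by
  have hs : s - s' = 0 := by
    refine eq_zero_of_degLt_tmul σ hf ?_
    have : tmul σ (s - s') f = r' - r := by
      rw [tmul_sub_left, sub_eq_sub_iff_add_eq_add, h, add_comm]
    rw [this]
    exact hr'.sub hr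
  obtain rfl := sub_eq_zero.1 hs
  exact ⟨rfl, add_left_cancel h⟩

variable {σ} {m : ℕ} {f : ℕ →₀ K} {mul : (ℕ →₀ K) → (ℕ →₀ K) → (ℕ →₀ K)}

theorem IsPetitMul.eq_of_tmul_eq (hmul : IsPetitMul σ m f mul) (hf : TMonic m f)
    {p q s r : ℕ →₀ K} (hp : DegLt m p) (hq : DegLt m q) (hr : DegLt m r)
    (h : tmul σ p q = tmul σ s f + r) : mul p q = r := by
  obtain ⟨hd, s', hs'⟩ := hmul p q hp hq
  exact (divMod_unique σ hf hd hr (hs'.symm.trans h)).2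

theorem IsPetitMul.eq_tmul (hmul : IsPetitMul σ m f mul) (hf : TMonic m f)
    {p q : ℕ →₀ K} (hp : DegLt m p) (hq : DegLt m q) (h : DegLt m (tmul σ p q)) :
    mul p q = tmul σ p q :=
  hmul.eq_of_tmul_eq hf hp hq h (s := 0) (by rw [tmul_zero_left, zero_add])

theorem degLt_tmul_single_zero_left {q : ℕ →₀ K} (hq : DegLt m q) (c : K) :
    DegLt m (tmul σ (Finsupp.single 0 c) q) :=
  fun i hi => by rw [tmul_single_zero_left_apply, hq i hi, mul_zero]

theorem degLt_tmul_single_zero_right {p : ℕ →₀ K} (hp : DegLt m p) (c : K) :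
    DegLt m (tmul σ p (Finsupp.single 0 c)) :=
  fun i hi => by rw [tmul_single_zero_right_apply, hp i hi, zero_mul]

/-- Constants lie in the left nucleus of a Petit algebra. -/
theorem IsPetitMul.assoc_single_zero (hmul : IsPetitMul σ m f mul) (hf : TMonic m f)
    (hm : 0 < m) (c : K) {q r : ℕ →₀ K} (hq : DegLt m q) (hr : DegLt m r) :
    mul (mul (Finsupp.single 0 c) q) r = mul (Finsupp.single 0 c) (mul q r) := by
  have hc := degLt_single hm c
  obtain ⟨hqr, s, hs⟩ := hmul q r hq hr
  have hcq := degLt_tmul_single_zero_left (σ := σ) hq c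
  have hcqr := degLt_tmul_single_zero_left (σ := σ) hqr c
  rw [hmul.eq_tmul hf hc hq hcq, hmul.eq_tmul hf hc hqr hcqr]
  refine hmul.eq_of_tmul_eq hf hcq hr hcqr (s := tmul σ (Finsupp.single 0 c) s) ?_
  rw [tmul_assoc, hs, tmul_add_right, tmul_assoc]

theorem rightInvariant_of_degLt (hm : 2 ≤ m)
    (h : ∀ r, DegLt m r → ∃ q', tmul σ f r = tmul σ q' f) : RightInvariant σ f := by
  have hmono : ∀ (i : ℕ) (c : K), ∃ q', tmul σ f (Finsupp.single i c) = tmul σ q' f := by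
    intro i
    induction i with
    | zero => exact fun c => h _ (degLt_single (by omega) c)
    | succ i ih =>
      intro c
      obtain ⟨a, ha⟩ := ih c
      obtain ⟨b, hb⟩ := h _ (degLt_single (i := 1) (by omega) 1)
      refine ⟨tmul σ a b, ?_⟩
      have : Finsupp.single (i + 1) c = tmul σ (Finsupp.single i c) (Finsupp.single 1 1) := by
        simp [tmul_single_single]
      rw [this, ← tmul_assoc, ha, tmul_assoc, hb, tmul_assoc]
  have hall : ∀ r, ∃ q', tmul σ f r = tmul σ q' f := by
    intro r
    induction r using Finsupp.induction_linear with
    | zero => exact ⟨0, by rw [tmul_zero_left, tmul_zero_right]⟩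
    | add r r' hr hr' =>
      obtain ⟨a, ha⟩ := hr
      obtain ⟨b, hb⟩ := hr'
      exact ⟨a + b, by rw [tmul_add_right, tmul_add_left, ha, hb]⟩
    | single i c => exact hmono i c
  intro q r
  obtain ⟨a, ha⟩ := hall r
  exact ⟨tmul σ q a, by rw [tmul_assoc, ha, tmul_assoc]⟩

/-- The left nucleus of a Petit algebra with `f` not right-invariant consists of constants. -/
theorem IsPetitMul.eq_single_zero_of_assoc (hmul : IsPetitMul σ m f mul) (hf : TMonic m f)
    (hm : 2 ≤ m) (hri : ¬ RightInvariant σ f) {p : ℕ →₀ K} (hp : DegLt m p)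
    (hassoc : ∀ q r, DegLt m q → DegLt m r → mul (mul p q) r = mul p (mul q r)) :
    p = Finsupp.single 0 (p 0) := by
  by_contra hne
  obtain ⟨i, hi⟩ := Finsupp.ne_iff.1 hne
  have hi0 : i ≠ 0 := by
    rintro rfl
    simp at hi
  rw [Finsupp.single_eq_of_ne hi0] at hi
  obtain ⟨d, hid, hd, hdeg⟩ := exists_leading_of_apply_ne_zero hi
  have hdm : d < m := by
    by_contra h
    exact hd (hp d (by omega))
  have hq : DegLt m (Finsupp.single (m - d) (1 : K)) := degLt_single (by omega) 1
  have hq' : DegLt (m - d + 1) (Finsupp.single (m - d) (1 : K)) := degLt_single (by omega) 1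
  obtain ⟨hpq, s, hs⟩ := hmul p _ hp hq
  have htop := tmul_apply_of_degLt σ hdeg hq'
  have hpqdeg := degLt_tmul σ hdeg hq'
  rw [show d + (m - d) = m by omega] at htop hpqdeg
  rw [Finsupp.single_eq_same, map_one, mul_one] at htop
  have hrem : DegLt m (tmul σ p (Finsupp.single (m - d) 1) -
      tmul σ (Finsupp.single 0 (p d)) f) := by
    intro k hk
    rw [Finsupp.sub_apply, tmul_single_zero_left_apply]
    rcases hk.eq_or_lt with rfl | hk
    · rw [htop, hf.1, mul_one, sub_self]
    · rw [hpqdeg k hk, hf.2 k hk, mul_zero, sub_self]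
  obtain ⟨rfl, -⟩ := divMod_unique σ hf hpq hrem (hs.symm.trans (add_sub_cancel _ _).symm)
  refine hri (rightInvariant_of_degLt hm fun r hr => ?_)
  obtain ⟨hqr, a, ha⟩ := hmul _ r hq hr
  obtain ⟨-, b, hb⟩ := hmul p _ hp hqr
  obtain ⟨-, c, hc⟩ := hmul _ r hpq hr
  rw [hassoc _ _ hq hr] at hc
  have key : tmul σ (tmul σ (Finsupp.single 0 (p d)) f) r =
      tmul σ (tmul σ p a + b - c) f := by
    have h1 : tmul σ (tmul σ p (Finsupp.single (m - d) 1)) r =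
        tmul σ (tmul σ p a) f + (tmul σ b f +
          mul p (mul (Finsupp.single (m - d) 1) r)) := by
      rw [tmul_assoc, ha, tmul_add_right, tmul_assoc, hb]
    rw [hs, tmul_add_left, hc] at h1
    rw [tmul_sub_left, tmul_add_left, eq_sub_of_add_eq h1]
    abel
  refine ⟨tmul σ (Finsupp.single 0 (p d)⁻¹) (tmul σ p a + b - c), ?_⟩
  rw [tmul_assoc, ← key, tmul_assoc, ← tmul_assoc, tmul_single_single]
  ext k
  rw [tmul_single_zero_left_apply]
  simp [inv_mul_cancel₀ hd]

end TwistedPolynomials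

/-- Let `K/F` be cyclic Galois of degree `n ≥ 3`, let
`σ₁ ≠ σ₂` be generators of `Gal(K/F)` with `σ₁ = σ₂^j`, `1 < j < n`,
`gcd(j,n) = 1`. Let `m ≥ 2` with `n ≥ m-1`, let `f ∈ K[t;σ₁]`, `g ∈ K[t;σ₂]` be
monic of degree `m`, neither right-invariant, and let `H : S_f → S_g` be an
`F`-algebra isomorphism. Then `H` maps constants to constants inducing some
`τ ∈ Gal(K/F)`, and `H(t) = k t^j` for some `k ∈ K^×`; in particular `j ≤ m-1`. -/
theorem stmt_6 {F K : Type*} [Field F] [Field K] [Algebra F K]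
    [IsGalois F K]
    (n : ℕ) (hdeg : Module.finrank F K = n) (hn : 3 ≤ n)
    (σ₁ σ₂ : K ≃ₐ[F] K)
    (hgen₁ : ∀ τ : K ≃ₐ[F] K, τ ∈ Subgroup.zpowers σ₁)
    (hgen₂ : ∀ τ : K ≃ₐ[F] K, τ ∈ Subgroup.zpowers σ₂)
    (hne : σ₁ ≠ σ₂)
    (j : ℕ) (hj1 : 1 < j) (hjn : j < n) (hjcop : Nat.Coprime j n)
    (hj : σ₁ = σ₂ ^ j)
    (m : ℕ) (hm : 2 ≤ m) (hnm : m - 1 ≤ n)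
    (f g : ℕ →₀ K) (hf : TMonic m f) (hg : TMonic m g)
    (hfri : ¬ RightInvariant σ₁ f) (hgri : ¬ RightInvariant σ₂ g)
    (mul₁ mul₂ : (ℕ →₀ K) → (ℕ →₀ K) → (ℕ →₀ K))
    (hmul₁ : IsPetitMul σ₁ m f mul₁) (hmul₂ : IsPetitMul σ₂ m g mul₂)
    (H : (ℕ →₀ K) →ₗ[F] (ℕ →₀ K))
    (hmaps : ∀ p : ℕ →₀ K, DegLt m p → DegLt m (H p))
    (hinj : ∀ p q : ℕ →₀ K, DegLt m p → DegLt m q → H p = H q → p = q)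
    (hsurj : ∀ q : ℕ →₀ K, DegLt m q → ∃ p : ℕ →₀ K, DegLt m p ∧ H p = q)
    (hmult : ∀ p q : ℕ →₀ K, DegLt m p → DegLt m q →
      H (mul₁ p q) = mul₂ (H p) (H q)) :
    (∃ τ : K ≃ₐ[F] K, ∀ c : K, H (Finsupp.single 0 c) = Finsupp.single 0 (τ c)) ∧
    (∃ k : K, k ≠ 0 ∧ H (Finsupp.single 1 1) = Finsupp.single j k) ∧
    j ≤ m - 1 := by
  have hm0 : 0 < m := by omega
  have : FiniteDimensional F K := FiniteDimensional.of_finrank_pos (by omega)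
  have hconst : ∀ c : K, H (Finsupp.single 0 c) =
      Finsupp.single 0 (H (Finsupp.single 0 c) 0) := by
    intro c
    have hc := degLt_single hm0 c
    refine hmul₂.eq_single_zero_of_assoc hg hm hgri (hmaps _ hc) fun q' r' hq' hr' => ?_
    obtain ⟨q, hq, rfl⟩ := hsurj q' hq'
    obtain ⟨r, hr, rfl⟩ := hsurj r' hr'
    rw [← hmult _ _ hc hq, ← hmult _ _ (hmul₁ _ _ hc hq).1 hr, ← hmult _ _ hq hr,
      ← hmult _ _ hc (hmul₁ _ _ hq hr).1, hmul₁.assoc_single_zero hf hm0 c hq hr]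
  let τ₀ : K →ₗ[F] K := Finsupp.lapply 0 ∘ₗ H ∘ₗ Finsupp.lsingle 0
  have hτ₀ : ∀ c, H (Finsupp.single 0 c) = Finsupp.single 0 (τ₀ c) := hconst
  have hτmul : ∀ a b, τ₀ (a * b) = τ₀ a * τ₀ b := by
    intro a b
    have h := hmult _ _ (degLt_single hm0 a) (degLt_single hm0 b)
    rw [hmul₁.eq_tmul hf (degLt_single hm0 a) (degLt_single hm0 b)
        (degLt_tmul_single_zero_left (degLt_single hm0 b) a), hτ₀, hτ₀,
      hmul₂.eq_tmul hg (degLt_single hm0 _) (degLt_single hm0 _)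
        (degLt_tmul_single_zero_left (degLt_single hm0 _) _),
      tmul_single_single, tmul_single_single, hτ₀] at h
    simpa only [add_zero, pow_zero, AlgEquiv.one_apply, Finsupp.single_eq_same] using
      DFunLike.congr_fun h 0
  have hτ1 : τ₀ 1 = 1 := by
    have h0 : τ₀ 1 ≠ 0 := by
      intro h0
      have := hinj _ 0 (degLt_single hm0 (1 : K)) (fun _ _ => rfl) (by rw [hτ₀, h0]; simp)
      simp at this
    have h1 := hτmul 1 1
    rw [mul_one] at h1
    exact (mul_eq_left₀ h0).1 h1.symm
  let τ : K ≃ₐ[F] K := AlgEquiv.ofBijective (AlgHom.ofLinearMap τ₀ hτ1 hτmul)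
    (Algebra.IsAlgebraic.algHom_bijective _)
  have hτ : ∀ c, H (Finsupp.single 0 c) = Finsupp.single 0 (τ c) := hτ₀
  have hcomm : τ * σ₁ = σ₁ * τ := by
    obtain ⟨z, hz⟩ := Subgroup.mem_zpowers_iff.1 (hgen₁ τ)
    rw [← hz]
    exact (Commute.zpow_self σ₁ z).eq
  have ht : DegLt m (Finsupp.single 1 (1 : K)) := degLt_single (by omega) 1
  have hHt := hmaps _ ht
  have hcoeff : ∀ i c, H (Finsupp.single 1 1) i * (σ₂ ^ i) (τ c) =
      σ₁ (τ c) * H (Finsupp.single 1 1) i := by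
    intro i c
    have hc := degLt_single hm0 c
    have hc' := degLt_single hm0 (σ₁ c)
    have h : mul₁ (Finsupp.single 1 1) (Finsupp.single 0 c) =
        mul₁ (Finsupp.single 0 (σ₁ c)) (Finsupp.single 1 1) := by
      rw [hmul₁.eq_tmul hf ht hc (degLt_tmul_single_zero_right ht c),
        hmul₁.eq_tmul hf hc' ht (degLt_tmul_single_zero_left ht _),
        tmul_single_single, tmul_single_single]
      simp
    have h' := congrArg H h
    rw [hmult _ _ ht hc, hmult _ _ hc' ht, hτ, hτ,
      hmul₂.eq_tmul hg hHt (degLt_single hm0 _) (degLt_tmul_single_zero_right hHt _),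
      hmul₂.eq_tmul hg (degLt_single hm0 _) hHt (degLt_tmul_single_zero_left hHt _)] at h'
    have h'' := DFunLike.congr_fun h' i
    rw [tmul_single_zero_left_apply, tmul_single_zero_right_apply] at h''
    rw [h'', ← AlgEquiv.mul_apply τ, hcomm, AlgEquiv.mul_apply]
  have hord : orderOf σ₂ = n := by
    rw [orderOf_eq_card_of_forall_mem_zpowers hgen₂, IsGalois.card_aut_eq_finrank, hdeg]
  have hsupp : ∀ i, H (Finsupp.single 1 1) i ≠ 0 → i = j := by
    intro i hi
    have him : i < m := by
      by_contra h
      exact hi (hHt i (by omega))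
    have hpow : σ₂ ^ i = σ₂ ^ j := by
      rw [← hj]
      ext c
      obtain ⟨c, rfl⟩ := τ.surjective c
      exact mul_left_cancel₀ hi ((hcoeff i c).trans (mul_comm _ _))
    rw [pow_eq_pow_iff_modEq, hord] at hpow
    rcases (show i ≤ n by omega).eq_or_lt with rfl | hin
    · have := Nat.mod_eq_of_lt hjn
      rw [Nat.ModEq, Nat.mod_self] at hpow
      omega
    · exact hpow.eq_of_lt_of_lt hin hjn
  have hHt_eq : H (Finsupp.single 1 1) = Finsupp.single j (H (Finsupp.single 1 1) j) := by
    ext i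
    by_cases hi : i = j
    · rw [hi, Finsupp.single_eq_same]
    · rw [Finsupp.single_eq_of_ne hi]
      by_contra h
      exact hi (hsupp i h)
  have hk : H (Finsupp.single 1 1) j ≠ 0 := by
    intro h0
    rw [h0, Finsupp.single_zero] at hHt_eq
    have := hinj _ 0 ht (fun _ _ => rfl) (by rw [hHt_eq, map_zero])
    simp at this
  refine ⟨⟨τ, hτ⟩, ⟨_, hk, hHt_eq⟩, ?_⟩
  by_contra h
  exact hk (hHt j (by omega))
end

section
/- Let K/F be a cyclic Galois field extension of degree m ≥ 2 with Gal(K/F) = ⟨σ⟩, let a ∈ K ∖ F, and let A = (K/F, σ, a) be the corresponding proper nonassociative cyclic algebra. Let s be the smallest positive integer with σ^s(a) = a; then the stabilizer {τ ∈ Gal(K/F) : τ(a) = a} equals ⟨σ^s⟩, s divides m, and the right nucleus of A is Nuc_r(A) = {Σ_{i=0}^{m−1} x_i t^i : x_i = 0 whenever s does not divide i} = K t^0 ⊕ K t^s ⊕ ⋯ ⊕ K t^{m−s}. In particular K t^0 ⊆ Nuc_r(A), the nucleus of A is Nuc(A) = K t^0, and if m is prime then Nuc_r(A) = K t^0. 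-/
/-- The left nucleus of a (nonassociative) multiplication. -/
def NucL {A : Type*} (mul : A → A → A) : Set A :=
  {x | ∀ y z : A, mul (mul x y) z = mul x (mul y z)}

/-- The middle nucleus of a (nonassociative) multiplication. -/
def NucM {A : Type*} (mul : A → A → A) : Set A :=
  {x | ∀ y z : A, mul (mul y x) z = mul y (mul x z)}

/-- The right nucleus of a (nonassociative) multiplication. -/
def NucR {A : Type*} (mul : A → A → A) : Set A :=
  {x | ∀ y z : A, mul (mul y z) x = mul y (mul z x)}

section PetitAlgebra

variable {F K : Type*} [Field F] [Field K] [Algebra F K]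

/-- The multiplication `petitMul` as a biadditive map. -/
noncomputable def petitMulHom (σ : K ≃ₐ[F] K) (a : K) (m : ℕ) :
    (Fin m → K) →+ (Fin m → K) →+ (Fin m → K) :=
  AddMonoidHom.mk' (fun x => AddMonoidHom.mk' (petitMul σ a m x) fun y z => by
      funext l
      simp only [petitMul, Pi.add_apply, map_add, mul_add, add_mul, ← Finset.sum_add_distrib,
        ite_add_zero]
      simp only [Finset.sum_add_distrib]
      ring) fun x y => by
    refine AddMonoidHom.ext fun z => funext fun l => ?_
    simp only [petitMul, AddMonoidHom.mk'_apply, AddMonoidHom.add_apply, Pi.add_apply, add_mul,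
      ← Finset.sum_add_distrib, ite_add_zero]
    simp only [Finset.sum_add_distrib]
    ring

theorem petitMulHom_apply (σ : K ≃ₐ[F] K) (a : K) (m : ℕ) (x y : Fin m → K) :
    petitMulHom σ a m x y = petitMul σ a m x y := rfl

theorem petitMul_single_apply (σ : K ≃ₐ[F] K) (a : K) {m : ℕ} (i j l : Fin m) (u v : K) :
    petitMul σ a m (Pi.single i u) (Pi.single j v) l =
      (if (i : ℕ) + j = l then u * (σ ^ (i : ℕ)) v else 0) +
        if (i : ℕ) + j = l + m then u * (σ ^ (i : ℕ)) v * (σ ^ (l : ℕ)) a else 0 := by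
  unfold petitMul
  congr 1
  all_goals
    rw [Finset.sum_eq_single i, Finset.sum_eq_single j]
    · simp
    · intro b _ hb
      simp [Pi.single_eq_of_ne hb]
    · simp
    · intro b _ hb
      simp [Pi.single_eq_of_ne hb]
    · simp

theorem petitMul_single_of_add_eq (σ : K ≃ₐ[F] K) (a : K) {m : ℕ} {i j l : Fin m}
    (h : (i : ℕ) + j = l) (u v : K) :
    petitMul σ a m (Pi.single i u) (Pi.single j v) = Pi.single l (u * (σ ^ (i : ℕ)) v) := by
  funext k
  rw [petitMul_single_apply, h, if_neg (by omega : ¬((l : ℕ) = k + m)), add_zero]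
  by_cases hk : k = l
  · simp [hk]
  · rw [Pi.single_eq_of_ne hk, if_neg fun h => hk (Fin.ext h.symm)]

theorem petitMul_single_of_add_eq_add (σ : K ≃ₐ[F] K) (a : K) {m : ℕ} {i j l : Fin m}
    (h : (i : ℕ) + j = l + m) (u v : K) :
    petitMul σ a m (Pi.single i u) (Pi.single j v) =
      Pi.single l (u * (σ ^ (i : ℕ)) v * (σ ^ (l : ℕ)) a) := by
  funext k
  rw [petitMul_single_apply, h, if_neg (by omega : ¬((l : ℕ) + m = k)), zero_add]
  by_cases hk : k = l
  · simp [hk]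
  · rw [Pi.single_eq_of_ne hk, if_neg fun h => hk (Fin.ext (by omega))]

theorem petitMul_assoc_of_single (σ : K ≃ₐ[F] K) (a : K) {m : ℕ} {x y z : Fin m → K}
    (h : ∀ i j k : Fin m,
      petitMul σ a m (petitMul σ a m (Pi.single i (x i)) (Pi.single j (y j)))
          (Pi.single k (z k)) =
        petitMul σ a m (Pi.single i (x i))
          (petitMul σ a m (Pi.single j (y j)) (Pi.single k (z k)))) :
    petitMul σ a m (petitMul σ a m x y) z = petitMul σ a m x (petitMul σ a m y z) := by
  simp only [← petitMulHom_apply] at h ⊢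
  rw [← Finset.univ_sum_single x, ← Finset.univ_sum_single y, ← Finset.univ_sum_single z]
  simp only [map_sum, AddMonoidHom.finsetSum_apply, h]

theorem petitMul_single_assoc {σ : K ≃ₐ[F] K} {a : K} {m : ℕ} (hσ : σ ^ m = 1)
    (i j k : Fin m) (u v w : K)
    (h : u = 0 ∨ v = 0 ∨ w = 0 ∨ (i : ℕ) = 0 ∨ (j : ℕ) = 0 ∨ (σ ^ (k : ℕ)) a = a) :
    petitMul σ a m (petitMul σ a m (Pi.single i u) (Pi.single j v)) (Pi.single k w) =
      petitMul σ a m (Pi.single i u) (petitMul σ a m (Pi.single j v) (Pi.single k w)) := by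
  have hpow : ∀ p q r : ℕ, p + q = r + m → ∀ b, (σ ^ p) ((σ ^ q) b) = (σ ^ r) b := by
    intro p q r hr b
    rw [← AlgEquiv.mul_apply, ← pow_add, hr, pow_add, hσ, mul_one]
  have hadd : ∀ p q r : ℕ, p + q = r → ∀ b, (σ ^ p) ((σ ^ q) b) = (σ ^ r) b := by
    rintro p q r rfl b
    rw [← AlgEquiv.mul_apply, ← pow_add]
  rcases eq_or_ne u 0 with rfl | hu
  · simp only [← petitMulHom_apply, Pi.single_zero, map_zero, AddMonoidHom.zero_apply]
  rcases eq_or_ne v 0 with rfl | hv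
  · simp only [← petitMulHom_apply, Pi.single_zero, map_zero, AddMonoidHom.zero_apply]
  rcases eq_or_ne w 0 with rfl | hw
  · simp only [← petitMulHom_apply, Pi.single_zero, map_zero]
  simp only [hu, hv, hw, false_or] at h
  rcases lt_or_ge ((i : ℕ) + j) m with hij | hij <;>
    rcases lt_or_ge ((j : ℕ) + k) m with hjk | hjk
  · rw [petitMul_single_of_add_eq σ a (l := ⟨i + j, hij⟩) rfl,
      petitMul_single_of_add_eq σ a (l := ⟨j + k, hjk⟩) rfl]
    rcases lt_or_ge ((i : ℕ) + j + k) m with hl | hl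
    · rw [petitMul_single_of_add_eq σ a (l := ⟨i + j + k, hl⟩) rfl,
        petitMul_single_of_add_eq σ a (l := ⟨i + j + k, hl⟩) (by simp only; omega),
        map_mul, hadd i j _ rfl, mul_assoc]
    · rw [petitMul_single_of_add_eq_add σ a (l := ⟨i + j + k - m, by omega⟩)
          (by simp only; omega),
        petitMul_single_of_add_eq_add σ a (l := ⟨i + j + k - m, by omega⟩)
          (by simp only; omega),
        map_mul, hadd i j _ rfl]
      congr 1
      ring
  · rw [petitMul_single_of_add_eq σ a (l := ⟨i + j, hij⟩) rfl,
      petitMul_single_of_add_eq_add σ a (i := j) (j := k) (l := ⟨j + k - m, by omega⟩)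
        (by simp only; omega),
      petitMul_single_of_add_eq_add σ a (l := ⟨i + j + k - m, by omega⟩) (by simp only; omega),
      petitMul_single_of_add_eq σ a (l := ⟨i + j + k - m, by omega⟩) (by simp only; omega),
      map_mul, map_mul, hadd i j _ rfl, hadd i (j + k - m) (i + j + k - m) (by omega)]
    congr 1
    ring
  · have hk : (σ ^ (k : ℕ)) a = a := by
      rcases h with h | h | h
      · omega
      · omega
      · exact h
    rw [petitMul_single_of_add_eq_add σ a (l := ⟨i + j - m, by omega⟩) (by simp only; omega),
      petitMul_single_of_add_eq σ a (i := j) (l := ⟨j + k, hjk⟩) rfl,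
      petitMul_single_of_add_eq σ a (l := ⟨i + j + k - m, by omega⟩) (by simp only; omega),
      petitMul_single_of_add_eq_add σ a (l := ⟨i + j + k - m, by omega⟩) (by simp only; omega),
      map_mul, hpow i j (i + j - m) (by omega), ← hadd (i + j - m) k (i + j + k - m) (by omega),
      hk]
    congr 1
    ring
  · have hk : (σ ^ (k : ℕ)) a = a := by
      rcases h with h | h | h
      · omega
      · omega
      · exact h
    have hk' : (σ ^ ((i : ℕ) + (j + k - m))) a = (σ ^ (i + j - m : ℕ)) a := by
      rw [← hadd (i + j - m) k (i + (j + k - m)) (by omega), hk]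
    rw [petitMul_single_of_add_eq_add σ a (i := i) (j := j) (l := ⟨i + j - m, by omega⟩)
        (by simp only; omega),
      petitMul_single_of_add_eq_add σ a (i := j) (j := k) (l := ⟨j + k - m, by omega⟩)
        (by simp only; omega)]
    rcases lt_or_ge ((i : ℕ) + j + k - m) m with hl | hl
    · rw [petitMul_single_of_add_eq σ a (l := ⟨i + j + k - m, hl⟩) (by simp only; omega),
        petitMul_single_of_add_eq σ a (l := ⟨i + j + k - m, hl⟩) (by simp only; omega),
        map_mul, map_mul, hpow i j (i + j - m) (by omega), hadd i (j + k - m) _ rfl, hk']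
      congr 1
      ring
    · rw [petitMul_single_of_add_eq_add σ a (l := ⟨i + j + k - m - m, by omega⟩)
          (by simp only; omega),
        petitMul_single_of_add_eq_add σ a (l := ⟨i + j + k - m - m, by omega⟩)
          (by simp only; omega),
        map_mul, map_mul, hpow i j (i + j - m) (by omega), hadd i (j + k - m) _ rfl, hk']
      congr 1
      ring

theorem petitMul_single_last_single_one (σ : K ≃ₐ[F] K) (a : K) {m : ℕ} (hm : 2 ≤ m) :
    petitMul σ a m (Pi.single ⟨m - 1, by omega⟩ 1) (Pi.single ⟨1, hm⟩ 1) =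
      Pi.single ⟨0, by omega⟩ a := by
  rw [petitMul_single_of_add_eq_add σ a (l := ⟨0, by omega⟩) (by simp only; omega)]
  simp

theorem apply_eq_zero_of_mem_nucR {σ : K ≃ₐ[F] K} {a : K} {m : ℕ} (hm : 2 ≤ m)
    (hσ : σ ^ m = 1) {x : Fin m → K} (hx : x ∈ NucR (petitMul σ a m)) {i : Fin m}
    (hi : (σ ^ (i : ℕ)) a ≠ a) : x i = 0 := by
  have h := hx (Pi.single ⟨m - 1, by omega⟩ 1) (Pi.single ⟨1, hm⟩ 1)
  rw [petitMul_single_last_single_one] at h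
  have hl : petitMul σ a m (Pi.single ⟨0, by omega⟩ a) x = fun k => a * x k := by
    conv_lhs => rw [← petitMulHom_apply, ← Finset.univ_sum_single x, map_sum]
    rw [← Finset.univ_sum_single fun k => a * x k]
    refine Finset.sum_congr rfl fun k _ => ?_
    rw [petitMulHom_apply, petitMul_single_of_add_eq σ a (l := k) (by simp)]
    simp
  have hr : petitMul σ a m (Pi.single ⟨m - 1, by omega⟩ 1) (petitMul σ a m (Pi.single ⟨1, hm⟩ 1) x)
      = fun k => x k * (σ ^ (k : ℕ)) a := by
    conv_lhs => rw [← petitMulHom_apply, ← petitMulHom_apply, ← Finset.univ_sum_single x,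
      map_sum, map_sum]
    rw [← Finset.univ_sum_single fun k => x k * (σ ^ (k : ℕ)) a]
    refine Finset.sum_congr rfl fun k _ => ?_
    have hσ' : ∀ b, (σ ^ (m - 1)) (σ b) = b := fun b => by
      rw [← AlgEquiv.mul_apply, ← pow_succ, Nat.sub_add_cancel (by omega), hσ, AlgEquiv.one_apply]
    rw [petitMulHom_apply, petitMulHom_apply]
    rcases lt_or_ge ((k : ℕ) + 1) m with hk | hk
    · rw [petitMul_single_of_add_eq σ a (l := ⟨k + 1, hk⟩) (by simp only; omega),
        petitMul_single_of_add_eq_add σ a (l := k) (by simp only; omega)]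
      simp [hσ']
    · rw [petitMul_single_of_add_eq_add σ a (l := ⟨0, by omega⟩) (by simp only; omega),
        petitMul_single_of_add_eq σ a (l := k) (by simp only; omega)]
      simp [hσ', show (k : ℕ) = m - 1 by omega, -AlgEquiv.coe_pow]
  rw [hl, hr] at h
  have h := congrFun h i
  by_contra hne
  exact hi (mul_left_cancel₀ hne (h.symm.trans (mul_comm _ _)))

theorem apply_eq_zero_of_mem_nucL {σ : K ≃ₐ[F] K} {a : K} {m : ℕ} (hm : 2 ≤ m)
    (hσa : σ a ≠ a) {x : Fin m → K} (hx : x ∈ NucL (petitMul σ a m)) {i : Fin m}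
    (hi : (i : ℕ) ≠ 0) : x i = 0 := by
  have h := hx (Pi.single ⟨m - 1, by omega⟩ 1) (Pi.single ⟨1, hm⟩ 1)
  rw [petitMul_single_last_single_one] at h
  have hr : petitMul σ a m x (Pi.single ⟨0, by omega⟩ a) = fun k => x k * (σ ^ (k : ℕ)) a := by
    conv_lhs => rw [← petitMulHom_apply, ← Finset.univ_sum_single x, map_sum,
      AddMonoidHom.finsetSum_apply]
    rw [← Finset.univ_sum_single fun k => x k * (σ ^ (k : ℕ)) a]
    refine Finset.sum_congr rfl fun k _ => ?_
    rw [petitMulHom_apply, petitMul_single_of_add_eq σ a (l := k) (by simp)]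
  have hl : petitMul σ a m (petitMul σ a m x (Pi.single ⟨m - 1, by omega⟩ 1)) (Pi.single ⟨1, hm⟩ 1)
      = fun k => x k * if (k : ℕ) = 0 then a else (σ ^ (k - 1 : ℕ)) a := by
    conv_lhs => rw [← petitMulHom_apply, ← petitMulHom_apply, ← Finset.univ_sum_single x,
      map_sum, AddMonoidHom.finsetSum_apply, map_sum, AddMonoidHom.finsetSum_apply]
    rw [← Finset.univ_sum_single fun k : Fin m =>
      x k * if (k : ℕ) = 0 then a else (σ ^ (k - 1 : ℕ)) a]
    refine Finset.sum_congr rfl fun k _ => ?_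
    rw [petitMulHom_apply, petitMulHom_apply]
    by_cases hk : (k : ℕ) = 0
    · rw [petitMul_single_of_add_eq σ a (l := ⟨m - 1, by omega⟩) (by simp only; omega),
        petitMul_single_of_add_eq_add σ a (l := k) (by simp only; omega)]
      simp [hk]
    · rw [petitMul_single_of_add_eq_add σ a (l := ⟨k - 1, by omega⟩) (by simp only; omega),
        petitMul_single_of_add_eq σ a (l := k) (by simp only; omega)]
      simp [hk]
  rw [hl, hr] at h
  have h := congrFun h i
  by_contra hne
  have h := mul_left_cancel₀ hne h
  obtain ⟨n, hn⟩ := Nat.exists_eq_succ_of_ne_zero hi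
  rw [if_neg hi, hn, Nat.succ_eq_add_one, Nat.add_sub_cancel, pow_succ, AlgEquiv.mul_apply] at h
  exact hσa ((σ ^ n).injective h).symm

end PetitAlgebra

/-- Let `K/F` be cyclic Galois of degree `m ≥ 2` with
`Gal(K/F) = ⟨σ⟩`, let `a ∈ K ∖ F` and `A = (K/F, σ, a)`. Let `s` be the
smallest positive integer with `σ^s(a) = a`. Then the stabilizer of `a` in
`Gal(K/F)` is `⟨σ^s⟩`, `s ∣ m`, and `Nuc_r(A) = K t^0 ⊕ K t^s ⊕ ⋯ ⊕ K t^{m-s}`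
(the elements supported on indices divisible by `s`). In particular
`K t^0 ⊆ Nuc_r(A)`, `Nuc(A) = K t^0`, and if `m` is prime then
`Nuc_r(A) = K t^0`. -/
theorem stmt_8 {F K : Type*} [Field F] [Field K] [Algebra F K]
    [IsGalois F K]
    (m : ℕ) (hm : 2 ≤ m) (hdeg : Module.finrank F K = m)
    (σ : K ≃ₐ[F] K)
    (hgen : ∀ τ : K ≃ₐ[F] K, τ ∈ Subgroup.zpowers σ)
    (a : K) (ha : a ∉ Set.range (algebraMap F K))
    (s : ℕ) (hs : 0 < s) (hsa : (σ ^ s) a = a)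
    (hmin : ∀ u : ℕ, 0 < u → (σ ^ u) a = a → s ≤ u) :
    {τ : K ≃ₐ[F] K | τ a = a} = (Subgroup.zpowers (σ ^ s) : Set (K ≃ₐ[F] K)) ∧
    s ∣ m ∧
    NucR (petitMul σ a m) =
      {x : Fin m → K | ∀ i : Fin m, ¬ s ∣ (i : ℕ) → x i = 0} ∧
    {x : Fin m → K | ∀ i : Fin m, (i : ℕ) ≠ 0 → x i = 0} ⊆ NucR (petitMul σ a m) ∧
    NucL (petitMul σ a m) ∩ NucM (petitMul σ a m) ∩ NucR (petitMul σ a m) =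
      {x : Fin m → K | ∀ i : Fin m, (i : ℕ) ≠ 0 → x i = 0} ∧
    (Nat.Prime m → NucR (petitMul σ a m) =
      {x : Fin m → K | ∀ i : Fin m, (i : ℕ) ≠ 0 → x i = 0}) := by
  have : FiniteDimensional F K := Module.finite_of_finrank_pos (by omega)
  have hσ : σ ^ m = 1 := by
    rw [← hdeg, ← IsGalois.card_aut_eq_finrank, pow_card_eq_one']
  have hper : MulAction.period σ a = s := by
    have hdvd : MulAction.period σ a ∣ s := (MulAction.pow_smul_eq_iff_period_dvd (m := σ) (a := a)).mp hsa
    exact le_antisymm (Nat.le_of_dvd hs hdvd)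
      (hmin _ (Nat.pos_of_dvd_of_pos hdvd hs) (MulAction.pow_period_smul σ a))
  have hfix : ∀ n : ℕ, (σ ^ n) a = a ↔ s ∣ n := fun n => by
    rw [← hper]
    exact MulAction.pow_smul_eq_iff_period_dvd (m := σ) (a := a)
  have hzfix : ∀ n : ℤ, (σ ^ n) a = a ↔ (s : ℤ) ∣ n := fun n => by
    rw [← hper]
    exact MulAction.zpow_smul_eq_iff_period_dvd (g := σ) (a := a)
  have hsm : s ∣ m := (hfix m).mp (by rw [hσ, AlgEquiv.one_apply])
  have hσa : σ a ≠ a := by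
    intro h
    have hs1 : s = 1 := Nat.dvd_one.mp ((hfix 1).mp (by rwa [pow_one]))
    refine ha (IntermediateField.mem_bot.mp ((IsGalois.mem_bot_iff_fixed a).mpr fun τ => ?_))
    obtain ⟨n, rfl⟩ := Subgroup.mem_zpowers_iff.mp (hgen τ)
    exact (hzfix n).mpr (by simp [hs1])
  have hR : NucR (petitMul σ a m) = {x : Fin m → K | ∀ i : Fin m, ¬ s ∣ (i : ℕ) → x i = 0} := by
    ext x
    refine ⟨fun hx i hi => apply_eq_zero_of_mem_nucR hm hσ hx (mt (hfix i).mp hi),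
      fun hx y z => petitMul_assoc_of_single σ a fun i j k =>
        petitMul_single_assoc hσ i j k _ _ _ ?_⟩
    by_cases hk : s ∣ (k : ℕ)
    · simp [(hfix k).mpr hk]
    · simp [hx k hk]
  have hKR : {x : Fin m → K | ∀ i : Fin m, (i : ℕ) ≠ 0 → x i = 0} ⊆ NucR (petitMul σ a m) := by
    rw [hR]
    exact fun x hx i hi => hx i fun h => hi (h ▸ dvd_zero s)
  refine ⟨?_, hsm, hR, hKR, ?_, fun hp => ?_⟩
  · ext τ
    obtain ⟨n, rfl⟩ := Subgroup.mem_zpowers_iff.mp (hgen τ)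
    rw [Set.mem_ofPred_eq, hzfix, SetLike.mem_coe, Subgroup.mem_zpowers_iff]
    constructor
    · rintro ⟨q, rfl⟩
      exact ⟨q, by rw [zpow_mul, zpow_natCast]⟩
    · rintro ⟨q, hq⟩
      rw [← hzfix, ← hq, ← zpow_natCast, ← zpow_mul, hzfix]
      exact dvd_mul_right _ _
  · refine Set.Subset.antisymm (fun x hx i hi => apply_eq_zero_of_mem_nucL hm hσa hx.1.1 hi)
      fun x hx => ⟨⟨fun y z => ?_, fun y z => ?_⟩, hKR hx⟩
    · refine petitMul_assoc_of_single σ a fun i j k => petitMul_single_assoc hσ i j k _ _ _ ?_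
      by_cases hi : (i : ℕ) = 0
      · simp [hi]
      · simp [hx i hi]
    · refine petitMul_assoc_of_single σ a fun i j k => petitMul_single_assoc hσ i j k _ _ _ ?_
      by_cases hj : (j : ℕ) = 0
      · simp [hj]
      · simp [hx j hj]
  · refine Set.Subset.antisymm (fun x hx i hi => ?_) hKR
    rw [hR] at hx
    refine hx i fun hdvd => ?_
    rcases (Nat.dvd_prime hp).mp hsm with h | h
    · exact hσa (by simpa using (hfix 1).mpr (by rw [h]))
    · exact absurd (Nat.le_of_dvd (Nat.pos_of_ne_zero hi) hdvd) (by omega)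
end

section
/- Let q be a prime power, F = 𝔽_q, K = 𝔽_{q^m} with m ≥ 2, σ a generator of Gal(K/F), and a ∈ K ∖ F. If a is fixed by some nontrivial element of Gal(K/F) (equivalently, a lies in a proper subfield 𝔽_{q^d} of 𝔽_{q^m} with d a proper divisor of m; equivalently, F(a) ≠ K), then the nonassociative cyclic algebra (𝔽_{q^m}/𝔽_q, σ, a) is not a division algebra, i.e. it has zero divisors. -/
/-- The product of the values at `b` of the powers of an automorphism `τ` attains every element
fixed by `τ`, for a finite extension of finite fields. -/
theorem exists_prod_pow_apply_eq {F K : Type*} [Field F] [Finite F] [Field K] [Algebra F K]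
    [FiniteDimensional F K] (τ : K ≃ₐ[F] K) {a : K} (ha : τ a = a) :
    ∃ b : K, ∏ k ∈ Finset.range (orderOf τ), (τ ^ k) b = a := by
  classical
  have : Finite K := Module.finite_of_finite F
  let H := Subgroup.zpowers τ
  let L := IntermediateField.fixedField H
  have haL : a ∈ L := by
    rintro ⟨g, hg⟩
    exact (Subgroup.zpowers_le (H := MulAction.stabilizer (K ≃ₐ[F] K) a)).mpr ha hg
  obtain ⟨b, hb⟩ := FiniteField.norm_surjective L K ⟨a, haL⟩
  refine ⟨b, ?_⟩
  have h := Algebra.norm_eq_prod_automorphisms L b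
  rw [hb] at h
  refine Eq.trans ?_ h.symm
  rw [Finset.prod_range, ← ((finEquivZPowers (isOfFinOrder_of_finite τ)).trans
    (IntermediateField.subgroupEquivAlgEquiv H).toEquiv).prod_comp]
  rfl

/-- Multiplication on the right by `t^d - b` in the algebra `K[t;σ]/K[t;σ](t^m - a)`. -/
theorem petitMul_pow_sub_apply {F K : Type*} [Field F] [Field K] [Algebra F K]
    (σ : K ≃ₐ[F] K) (a b : K) {m d : ℕ} (hd : 0 < d) (hdm : d < m) (X : ℕ → K) (l : Fin m) :
    petitMul σ a m (fun i => X i)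
        (fun j => if (j : ℕ) = d then 1 else if (j : ℕ) = 0 then -b else 0) l =
      (if d ≤ l then X (l - d) else X (l + m - d) * (σ ^ (l : ℕ)) a)
        - X l * (σ ^ (l : ℕ)) b := by
  have hm : 0 < m := hd.trans hdm
  have hne : (⟨d, hdm⟩ : Fin m) ≠ ⟨0, hm⟩ := by simp [hd.ne']
  have key (n : ℕ) (u : K) (i : Fin m) :
      (∑ j : Fin m, if (i : ℕ) + (j : ℕ) = n then X i * (σ ^ (i : ℕ))
        (if (j : ℕ) = d then 1 else if (j : ℕ) = 0 then -b else 0) * u else 0) =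
      (if (i : ℕ) + d = n then X i * u else 0)
        + (if (i : ℕ) = n then -(X i * (σ ^ (i : ℕ)) b * u) else 0) := by
    rw [Fintype.sum_eq_add _ _ hne]
    · simp [hd.ne]
    · rintro j ⟨h1, h2⟩
      have h1' : (j : ℕ) ≠ d := fun h => h1 (Fin.ext h)
      have h2' : (j : ℕ) ≠ 0 := fun h => h2 (Fin.ext h)
      simp [h1', h2']
  have keyOne (n : ℕ) (i : Fin m) := key n 1 i
  simp only [mul_one] at keyOne
  have single (g : ℕ → K) (c n : ℕ) :
      (∑ i : Fin m, if (i : ℕ) + c = n then g i else 0) =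
        if c ≤ n ∧ n < m + c then g (n - c) else 0 := by
    split_ifs with h
    · rw [Fintype.sum_eq_single (⟨n - c, by omega⟩ : Fin m)]
      · simp [Nat.sub_add_cancel h.1]
      · intro i hi
        exact if_neg fun h' => hi (Fin.ext (by simp; omega))
    · exact Finset.sum_eq_zero fun i _ => if_neg fun h' => h (by omega)
  have s1 := single X d l
  have s2 := single (fun i => -(X i * (σ ^ i) b)) 0 l
  have s3 := single (fun i => X i * (σ ^ (l : ℕ)) a) d (l + m)
  have s4 := single (fun i => -(X i * (σ ^ i) b * (σ ^ (l : ℕ)) a)) 0 (l + m)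
  simp only [add_zero] at s2 s4
  simp only [petitMul, key, keyOne, Finset.sum_add_distrib, s1, s2, s3, s4]
  have hl := l.2
  by_cases h : d ≤ (l : ℕ)
  · simp [h, hl, show (l : ℕ) < m + d by omega, show ¬ ((l : ℕ) + m < m + d) by omega,
      sub_eq_add_neg]
  · simp [h, hl, show (l : ℕ) + m < m + d by omega, show d ≤ (l : ℕ) + m by omega]
    ring

/-- If `a` is the product of the `σ^(dk) b` for `k < e`, then `t^d - b` is a right zero divisor in
`K[t;σ]/K[t;σ](t^(de) - a)`. -/
theorem exists_petitMul_eq_zero_of_prod_eq {F K : Type*} [Field F] [Field K] [Algebra F K]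
    (σ : K ≃ₐ[F] K) {a b : K} {d e : ℕ} (hd : 0 < d) (he : 1 < e)
    (hb : ∏ k ∈ Finset.range e, (σ ^ (d * k)) b = a) :
    ∃ x y : Fin (d * e) → K, x ≠ 0 ∧ y ≠ 0 ∧ petitMul σ a (d * e) x y = 0 := by
  have hdm : d < d * e := lt_mul_of_one_lt_right hd he
  let X : ℕ → K := fun i =>
    if d ∣ i then ∏ k ∈ Finset.Ico (i / d + 1) e, (σ ^ (d * k)) b else 0
  have hX (k : ℕ) : X (d * k) = ∏ j ∈ Finset.Ico (k + 1) e, (σ ^ (d * j)) b := by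
    simp [X, Nat.mul_div_cancel_left k hd]
  have hlast : X (d * (e - 1)) = 1 := by
    rw [hX, Finset.Ico_eq_empty (by omega), Finset.prod_empty]
  refine ⟨fun i => X i, fun j => if (j : ℕ) = d then 1 else if (j : ℕ) = 0 then -b else 0,
    fun h => ?_, fun h => ?_, ?_⟩
  · have := congrFun h ⟨d * (e - 1), Nat.mul_lt_mul_of_pos_left (by omega) hd⟩
    exact one_ne_zero (hlast.symm.trans this)
  · simpa using congrFun h ⟨d, hdm⟩
  · funext l
    rw [petitMul_pow_sub_apply σ a b hd hdm, Pi.zero_apply, sub_eq_zero]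
    by_cases hl : d ∣ (l : ℕ)
    · obtain ⟨k, hk⟩ := hl
      have hke : k < e := Nat.lt_of_mul_lt_mul_left (hk ▸ l.2 : d * k < d * e)
      have step : X (l : ℕ) * (σ ^ (l : ℕ)) b = ∏ j ∈ Finset.Ico k e, (σ ^ (d * j)) b := by
        rw [hk, hX, mul_comm, Finset.prod_eq_prod_Ico_succ_bot hke]
      rw [step, hk]
      rcases k with _ | k
      · rw [if_neg (by omega), mul_zero, zero_add, ← Nat.mul_sub_one, hlast, ← hb,
          Finset.range_eq_Ico]
        simp
      · rw [if_pos (Nat.le_mul_of_pos_right d k.succ_pos), ← Nat.mul_sub_one,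
          Nat.add_sub_cancel, hX]
    · have h1 : X (l : ℕ) = 0 := if_neg hl
      rw [h1, zero_mul]
      split_ifs with h
      · exact if_neg fun h' => hl ((Nat.dvd_sub_iff_left h dvd_rfl).mp h')
      · have : X (l + d * e - d) = 0 := if_neg fun h' => hl <| by
          rw [Nat.dvd_sub_iff_left (by omega) dvd_rfl] at h'
          exact (Nat.dvd_add_left (dvd_mul_right d e)).mp h'
        rw [this, zero_mul]

/-- Let `F = 𝔽_q`, `K = 𝔽_{q^m}` with `m ≥ 2`, `σ` a generator
of `Gal(K/F)`, and `a ∈ K ∖ F`. If `a` is fixed by some nontrivial element of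
`Gal(K/F)` (i.e. `a` lies in a proper subfield containing `F`), then the
nonassociative cyclic algebra `(𝔽_{q^m}/𝔽_q, σ, a)` is not a division algebra:
it has zero divisors. -/
theorem stmt_9 {F K : Type*} [Field F] [Finite F] [Field K] [Algebra F K]
    [IsGalois F K]
    (m : ℕ) (hm : 2 ≤ m) (hdeg : Module.finrank F K = m)
    (σ : K ≃ₐ[F] K)
    (hgen : ∀ τ : K ≃ₐ[F] K, τ ∈ Subgroup.zpowers σ)
    (a : K) (ha : a ∉ Set.range (algebraMap F K))
    (hfix : ∃ τ : K ≃ₐ[F] K, τ ≠ 1 ∧ τ a = a) :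
    ∃ x y : Fin m → K, x ≠ 0 ∧ y ≠ 0 ∧ petitMul σ a m x y = 0 := by
  have : FiniteDimensional F K := .of_finrank_pos (by omega)
  have hord : orderOf σ = m := by
    rw [orderOf_eq_card_of_forall_mem_zpowers hgen, IsGalois.card_aut_eq_finrank, hdeg]
  obtain ⟨τ, hτ, hτa⟩ := hfix
  obtain ⟨n, rfl⟩ := Subgroup.mem_zpowers_iff.mp (hgen τ)
  obtain ⟨e, he⟩ : Int.gcd n m ∣ m := by exact_mod_cast Int.gcd_dvd_right n m
  set d := Int.gcd n m with hd
  have hdpos : 0 < d := Nat.pos_of_ne_zero fun h => by simp [h] at he; omega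
  have hσd : (σ ^ d) a = a := by
    have h : σ ^ d = (σ ^ n) ^ Int.gcdA n m := by
      rw [← zpow_natCast, hd, Int.gcd_eq_gcd_ab, zpow_add, zpow_mul, zpow_mul, zpow_natCast,
        ← hord, pow_orderOf_eq_one, one_zpow, mul_one]
    rw [h]
    exact (MulAction.stabilizer (K ≃ₐ[F] K) a).zpow_mem hτa _
  have he1 : 1 < e := by
    by_contra h
    have hdm : d = m := by
      interval_cases e
      · omega
      · omega
    refine hτ (orderOf_dvd_iff_zpow_eq_one.mp ?_)
    rw [hord, ← hdm, hd]
    exact Int.gcd_dvd_left n m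
  have horde : orderOf (σ ^ d) = e := by
    rw [orderOf_pow_of_dvd hdpos.ne' (by rw [hord, he]; exact dvd_mul_right d e), hord]
    exact Nat.div_eq_of_eq_mul_right hdpos he
  obtain ⟨b, hb⟩ := exists_prod_pow_apply_eq (σ ^ d) hσd
  simp only [horde, ← pow_mul] at hb
  rw [he]
  exact exists_petitMul_eq_zero_of_prod_eq σ hdpos he1 hb
end
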